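/- arXiv:1506.07509 — 3 statements merged into one kernel-verified Lean document; each statement's English description precedes it below -/
import Mathlib

section
/- Let n ≥ m ≥ 1 be integers, let ν, k be reals with ν/2 + k > 0, and let τ = (t_1,…,t_m) ∈ ℝ^m with t_1 ≥ … ≥ t_m and n/2 > (m−1)/2 − t_m. Let μ be the measure on (0,∞) × ℝ^{n×m} whose density with respect to Lebesgue measure at (s_1, Y) is [1/Γ(ν/2+k)] s_1^{ν/2+k−1} e^{−s_1} · [Γ_m(n/2)/(π^{mn/2} Γ_m(n/2, τ))] e^{−tr(YᵀY)} q_τ(YᵀY) (the joint density of an independent pair of a Riesz scalar S_1 and a standardized Kotz–Riesz matrix Y). Define φ(s_1, Y) = (s, s^{−1/2} Y) where s = s_1 + tr(YᵀY). Then the pushforward of μ under φ equals the product measure λ ⊗ π, where λ on (0,∞) has density s ↦ [1/Γ((ν+mn)/2 + k + Σ_{i=1}^m t_i)] s^{(ν+mn)/2 + k + Σ_{i=1}^m t_i − 1} e^{−s}, and π on ℝ^{n×m} has density R ↦ [Γ_m(n/2) Γ((ν+mn)/2 + k + Σ_{i=1}^m t_i)]/[π^{mn/2} Γ_m(n/2,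 τ) Γ(ν/2+k)] · (1 − tr(RᵀR))^{ν/2+k−1} q_τ(RᵀR) on the set {R : tr(RᵀR) < 1} and 0 elsewhere. In particular, S = S_1 + ‖Y‖² and R = S^{−1/2} Y are independent, S has the stated gamma-type (Riesz) density, and R has the standardized matrix multivariate Pearson type II-Riesz density. -/
open MeasureTheory Matrix Real

instance matMeasurableSpace {n m : ℕ} {α : Type*} [MeasurableSpace α] :
    MeasurableSpace (Matrix (Fin n) (Fin m) α) :=
  inferInstanceAs (MeasurableSpace (Fin n → Fin m → α))

noncomputable instance matMeasureSpace {n m : ℕ} {α : Type*} [MeasureSpace α]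
    [SigmaFinite (volume : Measure α)] : MeasureSpace (Matrix (Fin n) (Fin m) α) :=
  inferInstanceAs (MeasureSpace (Fin n → Fin m → α))

/-- Determinant of the leading principal `i × i` submatrix. -/
noncomputable def leadMinor {m : ℕ} (A : Matrix (Fin m) (Fin m) ℝ) (i : ℕ) : ℝ :=
  if h : i ≤ m then (A.submatrix (Fin.castLE h) (Fin.castLE h)).det else 0

/-- Highest weight vector `q_τ(A) = det(A)^{t_m} ∏_{i=1}^{m−1} det(A_i)^{t_i − t_{i+1}}`. -/
noncomputable def hwVector {m : ℕ} (τ : Fin m → ℝ) (A : Matrix (Fin m) (Fin m) ℝ) : ℝ :=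
  ∏ i : Fin m,
    leadMinor A ((i : ℕ) + 1) ^ (τ i - if h : (i : ℕ) + 1 < m then τ ⟨(i : ℕ) + 1, h⟩ else 0)

/-- Real multivariate gamma function `Γ_m(a)`. -/
noncomputable def mvGamma (m : ℕ) (a : ℝ) : ℝ :=
  π ^ ((m : ℝ) * ((m : ℝ) - 1) / 4) * ∏ i : Fin m, Gamma (a - (i : ℝ) / 2)

/-- Generalized gamma function of weight `τ`, `Γ_m(a, τ)`. -/
noncomputable def mvGammaW {m : ℕ} (a : ℝ) (τ : Fin m → ℝ) : ℝ :=
  π ^ ((m : ℝ) * ((m : ℝ) - 1) / 4) * ∏ i : Fin m, Gamma (a + τ i - (i : ℝ) / 2)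

theorem leadMinor_smul {m : ℕ} (c : ℝ) (A : Matrix (Fin m) (Fin m) ℝ) (i : ℕ) :
    leadMinor (c • A) i = c ^ i * leadMinor A i := by
  unfold leadMinor
  split_ifs
  · change (c • A.submatrix _ _).det = _
    rw [Matrix.det_smul, Fintype.card_fin]
  · simp

theorem leadMinor_nonneg {m : ℕ} {A : Matrix (Fin m) (Fin m) ℝ} (hA : A.PosSemidef) (i : ℕ) :
    0 ≤ leadMinor A i := by
  unfold leadMinor
  split_ifs
  · exact (hA.submatrix _).det_nonneg
  · exact le_rfl

theorem sum_succ_mul_sub_succ {m : ℕ} (τ : Fin m → ℝ) :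
    ∑ i : Fin m, ((i : ℝ) + 1) * (τ i - if h : (i : ℕ) + 1 < m then τ ⟨(i : ℕ) + 1, h⟩ else 0) =
      ∑ i, τ i := by
  set u : ℕ → ℝ := fun j => if h : j < m then τ ⟨j, h⟩ else 0 with hu
  have h1 : ∀ i : Fin m, τ i = u i := fun i => by simp [hu]
  have h2 (j : ℕ) : ∑ i ∈ Finset.range j, ((i : ℝ) + 1) * (u i - u (i + 1)) =
      ∑ i ∈ Finset.range j, u i - j * u j := by
    induction j with
    | zero => simp
    | succ j ih => rw [Finset.sum_range_succ, Finset.sum_range_succ, ih]; push_cast; ring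
  calc _ = ∑ i : Fin m, ((i : ℝ) + 1) * (u i - u (i + 1)) :=
        Finset.sum_congr rfl fun i _ => by rw [h1 i]
    _ = ∑ i : Fin m, u i := by
        rw [Fin.sum_univ_eq_sum_range (fun i => ((i : ℝ) + 1) * (u i - u (i + 1))), h2,
          Fin.sum_univ_eq_sum_range]
        simp [hu]
    _ = _ := by simp_rw [h1]

theorem hwVector_smul {m : ℕ} (τ : Fin m → ℝ) {c : ℝ} (hc : 0 < c)
    {A : Matrix (Fin m) (Fin m) ℝ} (hA : A.PosSemidef) :
    hwVector τ (c • A) = c ^ (∑ i, τ i) * hwVector τ A := by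
  unfold hwVector
  rw [← sum_succ_mul_sub_succ τ, Real.rpow_sum_of_pos hc, ← Finset.prod_mul_distrib]
  refine Finset.prod_congr rfl fun i _ => ?_
  rw [leadMinor_smul, Real.mul_rpow (by positivity) (leadMinor_nonneg hA _), Real.rpow_mul hc.le]
  norm_cast

theorem measurable_gram_apply {n m : ℕ} (i j : Fin m) :
    Measurable fun Y : Fin n → Fin m → ℝ => ((Matrix.of Y)ᵀ * Matrix.of Y) i j := by
  simp only [Matrix.mul_apply, Matrix.transpose_apply, Matrix.of_apply]
  fun_prop

theorem measurable_trace_gram {n m : ℕ} :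
    Measurable fun Y : Fin n → Fin m → ℝ => ((Matrix.of Y)ᵀ * Matrix.of Y).trace := by
  simp only [Matrix.trace, Matrix.diag]
  exact Finset.measurable_sum _ fun i _ => measurable_gram_apply i i

theorem measurable_hwVector_gram {n m : ℕ} (τ : Fin m → ℝ) :
    Measurable fun Y : Fin n → Fin m → ℝ => hwVector τ ((Matrix.of Y)ᵀ * Matrix.of Y) := by
  unfold hwVector
  refine Finset.measurable_prod _ fun i _ => Measurable.pow_const ?_ _
  unfold leadMinor
  split_ifs
  · simp only [Matrix.det_apply, Matrix.submatrix_apply]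
    exact Finset.measurable_sum _ fun σ _ =>
      (Finset.measurable_prod _ fun j _ => measurable_gram_apply _ _).const_smul _
  · exact measurable_const

theorem lintegral_eq_lintegral_comp_smul {E : Type*} [NormedAddCommGroup E] [NormedSpace ℝ E]
    [FiniteDimensional ℝ E] [MeasurableSpace E] [BorelSpace E] (μ : Measure E)
    [μ.IsAddHaarMeasure] (f : E → ENNReal) (hf : Measurable f) {c : ℝ} (hc : 0 < c) :
    ∫⁻ x, f x ∂μ = ENNReal.ofReal (c ^ Module.finrank ℝ E) * ∫⁻ x, f (c • x) ∂μ := by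
  rw [← lintegral_map hf (measurable_const_smul c), Measure.map_addHaar_smul μ hc.ne',
    lintegral_smul_measure, smul_eq_mul, ← mul_assoc, abs_of_pos (by positivity),
    ← ENNReal.ofReal_mul (by positivity), mul_inv_cancel₀ (by positivity), ENNReal.ofReal_one,
    one_mul]

/-- Change of variables `(s₁, Y) ↦ (s, s ^ (-1/2) • Y)` with `s = s₁ + N Y`, for a density whose
expression in the new variables is a product. -/
theorem map_add_smul_withDensity_eq_prod {E : Type*} [NormedAddCommGroup E] [NormedSpace ℝ E]
    [FiniteDimensional ℝ E] [MeasurableSpace E] [BorelSpace E] (μ : Measure E)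
    [μ.IsAddHaarMeasure] {N : E → ℝ} (hN : Measurable N) (hN0 : ∀ x, 0 ≤ N x)
    {f : ℝ × E → ENNReal} {u : ℝ → ENNReal} {v : E → ENNReal}
    (hf : Measurable f) (hu : Measurable u) (hv : Measurable v)
    (hf0 : ∀ s ≤ 0, ∀ x, f (s, x) = 0) (hu0 : ∀ s ≤ 0, u s = 0)
    (h : ∀ s, 0 < s → ∀ x, ENNReal.ofReal (√s ^ Module.finrank ℝ E) *
      f (s - N (√s • x), √s • x) = u s * v x) :
    Measure.map
      (fun p : ℝ × E => (p.1 + N p.2, ((p.1 + N p.2) ^ (-(1 / 2) : ℝ)) • p.2))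
      ((volume.prod μ).withDensity f) =
    Measure.prod (volume.withDensity u) (μ.withDensity v) := by
  have hφ : Measurable fun p : ℝ × E =>
      (p.1 + N p.2, ((p.1 + N p.2) ^ (-(1 / 2) : ℝ)) • p.2) := by fun_prop
  rw [prod_withDensity hu hv]
  refine Measure.ext_of_lintegral _ fun g hg => ?_
  rw [lintegral_map hg hφ, lintegral_withDensity_eq_lintegral_mul _ hf (by fun_prop),
    lintegral_withDensity_eq_lintegral_mul _ (by fun_prop) hg,
    lintegral_prod_symm' _ (by fun_prop), lintegral_prod _ (by fun_prop)]
  simp only [Pi.mul_apply]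
  have shear (y : E) : ∫⁻ s, f (s, y) * g (s + N y, ((s + N y) ^ (-(1 / 2) : ℝ)) • y) =
      ∫⁻ s, f (s - N y, y) * g (s, (s ^ (-(1 / 2) : ℝ)) • y) := by
    simpa only [add_sub_cancel_right] using lintegral_add_right_eq_self (μ := volume)
      (fun s => f (s - N y, y) * g (s, (s ^ (-(1 / 2) : ℝ)) • y)) (N y)
  simp only [shear]
  rw [lintegral_lintegral_swap (by unfold Function.uncurry; fun_prop)]
  refine lintegral_congr fun s => ?_
  rcases le_or_gt s 0 with hs | hs
  · simp [hu0 s hs, fun x => hf0 (s - N x) (by linarith [hN0 x])]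
  have hr : 0 < √s := Real.sqrt_pos.2 hs
  rw [lintegral_eq_lintegral_comp_smul μ _ (by fun_prop) hr,
    ← lintegral_const_mul _ (by fun_prop)]
  refine lintegral_congr fun x => ?_
  have hinv : s ^ (-(1 / 2) : ℝ) • √s • x = x := by
    rw [smul_smul, Real.sqrt_eq_rpow, ← Real.rpow_add hs]; simp
  rw [hinv, ← mul_assoc, h s hs x]

/-- If `N` is homogeneous of degree `2` and `q` is homogeneous of degree `2 * t`, the total
`s₁ + N Y` of a gamma variable and the quadratic form `N` is independent of `Y` rescaled by the
square root of this total. -/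
theorem map_add_smul_withDensity_gamma_eq_prod {E : Type*} [NormedAddCommGroup E]
    [NormedSpace ℝ E] [FiniteDimensional ℝ E] [MeasurableSpace E] [BorelSpace E] (μ : Measure E)
    [μ.IsAddHaarMeasure] {N q : E → ℝ} (hN : Measurable N) (hq : Measurable q)
    (hN0 : ∀ x, 0 ≤ N x) (hNs : ∀ c : ℝ, 0 < c → ∀ x, N (c • x) = c ^ 2 * N x) {t : ℝ}
    (hqs : ∀ c : ℝ, 0 < c → ∀ x, q (c • x) = (c ^ 2) ^ t * q x) {a b d e : ℝ}
    (hb : b = a + Module.finrank ℝ E / 2 + t) (hb0 : 0 < b) :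
    Measure.map
      (fun p : ℝ × E => (p.1 + N p.2, ((p.1 + N p.2) ^ (-(1 / 2) : ℝ)) • p.2))
      ((volume.prod μ).withDensity fun p : ℝ × E =>
        ENNReal.ofReal
          (if 0 < p.1 then
            1 / Gamma a * p.1 ^ (a - 1) * Real.exp (-p.1) * (d / e) * Real.exp (-N p.2) * q p.2
          else 0)) =
    Measure.prod
      (volume.withDensity fun s : ℝ =>
        ENNReal.ofReal (if 0 < s then 1 / Gamma b * s ^ (b - 1) * Real.exp (-s) else 0))
      (μ.withDensity fun R : E =>
        ENNReal.ofReal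
          (if N R < 1 then d * Gamma b / (e * Gamma a) * (1 - N R) ^ (a - 1) * q R else 0)) := by
  have hΓ : 0 < Gamma b := Real.Gamma_pos_of_pos hb0
  refine map_add_smul_withDensity_eq_prod μ hN hN0
    (Measurable.ite (measurableSet_lt measurable_const measurable_fst) (by fun_prop)
      measurable_const).ennreal_ofReal
    (Measurable.ite (measurableSet_lt measurable_const measurable_id) (by fun_prop)
      measurable_const).ennreal_ofReal
    (Measurable.ite (measurableSet_lt hN measurable_const) (by fun_prop)
      measurable_const).ennreal_ofReal
    (fun s hs x => by simp [hs.not_gt]) (fun s hs => by simp [hs.not_gt]) fun s hs x => ?_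
  have hr : 0 < √s := Real.sqrt_pos.2 hs
  simp only [hs, if_true, hNs _ hr, hqs _ hr, Real.sq_sqrt hs.le]
  rw [← ENNReal.ofReal_mul (by positivity), ← ENNReal.ofReal_mul (by positivity)]
  congr 1
  by_cases hx : N x < 1
  · have h1 : 0 < 1 - N x := by linarith
    have h2 : s - s * N x = s * (1 - N x) := by ring
    have h3 : √s ^ Module.finrank ℝ E = s ^ ((Module.finrank ℝ E : ℝ) / 2) := by
      rw [Real.sqrt_eq_rpow, ← Real.rpow_natCast, ← Real.rpow_mul hs.le]; congr 1; ring
    have h4 : s ^ (b - 1) = s ^ ((Module.finrank ℝ E : ℝ) / 2) * s ^ (a - 1) * s ^ t := by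
      rw [← Real.rpow_add hs, ← Real.rpow_add hs, hb]; congr 1; ring
    have h5 : Real.exp (-s) = Real.exp (-(s * (1 - N x))) * Real.exp (-(s * N x)) := by
      rw [← Real.exp_add]; congr 1; ring
    rw [h2, if_pos (by positivity), if_pos hx, h3, h4, h5, Real.mul_rpow hs.le h1.le]
    field_simp
  · have : ¬ 0 < s - s * N x := by nlinarith
    simp [hx, this]

/-- Theorem 3.1 (β = 1). Let `μ` be the joint law of an independent pair `(S₁, Y)` of a
scalar Riesz variable `S₁ ∼ R₁(ν/2, k, 1)` (supported on `(0,∞)`) and a standardized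
Kotz–Riesz matrix `Y ∼ KR_{n×m}(τ, 0, Iₙ, Iₘ)`. Under the map
`φ(s₁, Y) = (s, s^{−1/2} Y)` with `s = s₁ + tr(YᵀY)`, the pushforward of `μ` is the product
of a gamma-type (Riesz) law for `S = S₁ + ‖Y‖²` and the standardized matrix multivariate
Pearson type II-Riesz law for `R = S^{−1/2} Y`; in particular `S` and `R` are independent. -/
theorem pearsonII_riesz_construction {n m : ℕ} (hm : 1 ≤ m) (hnm : m ≤ n)
    (ν k : ℝ) (hνk : 0 < ν / 2 + k) (τ : Fin m → ℝ) (hτ : Antitone τ)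
    (hn : ((m : ℝ) - 1) / 2 - τ ⟨m - 1, by omega⟩ < (n : ℝ) / 2) :
    Measure.map
      (fun p : ℝ × Matrix (Fin n) (Fin m) ℝ =>
        (p.1 + (p.2ᵀ * p.2).trace,
          ((p.1 + (p.2ᵀ * p.2).trace) ^ (-(1 / 2) : ℝ)) • p.2))
      (volume.withDensity fun p : ℝ × Matrix (Fin n) (Fin m) ℝ =>
        ENNReal.ofReal
          (if 0 < p.1 then
            1 / Gamma (ν / 2 + k) * p.1 ^ (ν / 2 + k - 1) * Real.exp (-p.1) *
              (mvGamma m ((n : ℝ) / 2) /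
                (π ^ ((m : ℝ) * n / 2) * mvGammaW ((n : ℝ) / 2) τ)) *
              Real.exp (-(p.2ᵀ * p.2).trace) * hwVector τ (p.2ᵀ * p.2)
          else 0)) =
    Measure.prod
      (volume.withDensity fun s : ℝ =>
        ENNReal.ofReal
          (if 0 < s then
            1 / Gamma ((ν + m * n) / 2 + k + ∑ i, τ i) *
              s ^ ((ν + m * n) / 2 + k + ∑ i, τ i - 1) * Real.exp (-s)
          else 0))
      (volume.withDensity fun R : Matrix (Fin n) (Fin m) ℝ =>
        ENNReal.ofReal
          (if (Rᵀ * R).trace < 1 then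
            mvGamma m ((n : ℝ) / 2) * Gamma ((ν + m * n) / 2 + k + ∑ i, τ i) /
                (π ^ ((m : ℝ) * n / 2) * mvGammaW ((n : ℝ) / 2) τ * Gamma (ν / 2 + k)) *
              (1 - (Rᵀ * R).trace) ^ (ν / 2 + k - 1) * hwVector τ (Rᵀ * R)
          else 0)) := by
  have hsum : (m : ℝ) * (((m : ℝ) - 1) / 2 - (n : ℝ) / 2) ≤ ∑ i, τ i := by
    have : ∀ i ∈ (Finset.univ : Finset (Fin m)), ((m : ℝ) - 1) / 2 - (n : ℝ) / 2 ≤ τ i := by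
      intro i _
      have : τ ⟨m - 1, by omega⟩ ≤ τ i := hτ (Fin.le_def.2 (by simp; omega))
      linarith
    simpa using Finset.card_nsmul_le_sum _ _ _ this
  have hm' : (1 : ℝ) ≤ m := by exact_mod_cast hm
  have hpsd (Y : Matrix (Fin n) (Fin m) ℝ) : (Yᵀ * Y).PosSemidef := by
    simpa using Matrix.posSemidef_conjTranspose_mul_self Y
  have hgram (c : ℝ) (Y : Matrix (Fin n) (Fin m) ℝ) : (c • Y)ᵀ * (c • Y) = c ^ 2 • (Yᵀ * Y) := by
    simp [smul_smul, sq]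
  exact map_add_smul_withDensity_gamma_eq_prod (E := Fin n → Fin m → ℝ) volume
    (N := fun Y => ((Matrix.of Y)ᵀ * Matrix.of Y).trace)
    (q := fun Y => hwVector τ ((Matrix.of Y)ᵀ * Matrix.of Y))
    measurable_trace_gram (measurable_hwVector_gram τ) (fun Y => (hpsd (Matrix.of Y)).trace_nonneg)
    (fun c _ Y => by
      change ((c • Matrix.of Y)ᵀ * (c • Matrix.of Y)).trace = _
      rw [hgram, Matrix.trace_smul, smul_eq_mul])
    (t := ∑ i, τ i)
    (fun c hc Y => by
      change hwVector τ ((c • Matrix.of Y)ᵀ * (c • Matrix.of Y)) = _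
      rw [hgram, hwVector_smul τ (by positivity) (hpsd _)])
    (a := ν / 2 + k)
    (by simp [Module.finrank_pi_fintype]; ring)
    (by nlinarith)
end

section
/- Let n ≥ m ≥ 1 be integers. For every measurable function f from the space of m×m complex Hermitian matrices to [0,∞], ∫_{ℂ^{n×m}} f(X*X) dX = [π^{mn}/Γ̃_m(n)] ∫_{{S : S m×m complex Hermitian positive definite}} f(S) (det S)^{n−m} dS, where Γ̃_m(n) = π^{m(m−1)/2} ∏_{i=1}^m Γ(n − i + 1), X* is the conjugate transpose, the left integral is with respect to Lebesgue measure on ℂ^{n×m} (real and imaginary parts of entries), and the right integral is with respect to the Lebesgue measure on Hermitian matrices given by the real diagonal entries and the real and imaginary parts of the above-diagonal entries. -/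
open MeasureTheory Matrix Real
open scoped ComplexOrder

/-- Complex multivariate gamma function `Γ̃_m(n) = π^{m(m−1)/2} ∏_{i=1}^m Γ(n − i + 1)`. -/
noncomputable def cmvGamma (m : ℕ) (a : ℝ) : ℝ :=
  π ^ ((m : ℝ) * ((m : ℝ) - 1) / 2) * ∏ i : Fin m, Gamma (a - (i : ℝ))

/-- Lebesgue measure on the space of `m × m` complex Hermitian matrices, given by the real
diagonal entries and the real and imaginary parts of the above-diagonal entries. -/
noncomputable def hermMeasure (m : ℕ) : Measure (Matrix (Fin m) (Fin m) ℂ) :=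
  Measure.map
    (fun fd : ({p : Fin m × Fin m // p.1 < p.2} → ℂ) × (Fin m → ℝ) =>
      Matrix.of fun i j =>
        if h : i < j then fd.1 ⟨(i, j), h⟩
        else if h' : j < i then star (fd.1 ⟨(j, i), h'⟩)
        else (fd.2 i : ℂ))
    volume

/-- Polar integration of a function of the squared Euclidean norm on `ι → ℂ`. -/
theorem lintegral_comp_sum_norm_sq {ι : Type*} [Fintype ι] [Nonempty ι] {φ : ℝ → ENNReal}
    (hφ : Measurable φ) :
    ∫⁻ y : ι → ℂ, φ (∑ i, ‖y i‖ ^ 2) =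
      ENNReal.ofReal (π ^ Fintype.card ι / Gamma (Fintype.card ι)) *
        ∫⁻ s in Set.Ioi (0 : ℝ), φ s * ENNReal.ofReal (s ^ (Fintype.card ι - 1)) := by
  obtain ⟨d, hd⟩ : ∃ d, Fintype.card ι = d + 1 :=
    Nat.exists_eq_succ_of_ne_zero Fintype.card_ne_zero
  have hmeas : Measurable fun y : ι → ℂ => ∑ i, ‖y i‖ ^ 2 := by fun_prop
  have hmeas' : Measurable fun s : ℝ => ENNReal.ofReal (s ^ d) := by fun_prop
  have hset {r : ℝ} (hr : 0 ≤ r) : {y : ι → ℂ | ∑ i, ‖y i‖ ^ 2 ≤ r} =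
      {y : ι → ℂ | (∑ i, ‖y i‖ ^ (2 : ℝ)) ^ (1 / 2 : ℝ) ≤ √r} := by
    ext y
    simp only [Set.mem_ofPred_eq, ← Real.sqrt_eq_rpow, Real.rpow_two]
    rw [Real.sqrt_le_sqrt_iff hr]
  have hball (r : ℝ) : volume {y : ι → ℂ | ∑ i, ‖y i‖ ^ 2 ≤ r} =
      ENNReal.ofReal (π ^ (d + 1) / Gamma (d + 1 : ℕ)) *
        ∫⁻ s in Set.Iic r ∩ Set.Ioi 0, ENNReal.ofReal (s ^ d) := by
    rcases le_or_gt r 0 with hr | hr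
    · have h1 : Set.Iic r ∩ Set.Ioi 0 = ∅ := by
        ext x; simp only [Set.mem_inter_iff, Set.mem_Iic, Set.mem_Ioi, Set.mem_empty_iff_false]
        constructor
        · rintro ⟨h, h'⟩; linarith
        · exact False.elim
      have h2 : {y : ι → ℂ | ∑ i, ‖y i‖ ^ 2 ≤ r} ⊆ {0} := fun y hy => by
        have h0 : ∑ i, ‖y i‖ ^ 2 = 0 :=
          le_antisymm (le_trans hy hr) (Finset.sum_nonneg fun i _ => by positivity)
        rw [Finset.sum_eq_zero_iff_of_nonneg fun i _ => by positivity] at h0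
        ext i
        simpa using h0 i (Finset.mem_univ i)
      rw [h1, measure_mono_null h2 (measure_singleton _)]
      simp
    · have hint : ∫⁻ s in Set.Iic r ∩ Set.Ioi 0, ENNReal.ofReal (s ^ d) =
          ENNReal.ofReal (r ^ (d + 1) / (d + 1)) := by
        rw [Set.inter_comm, Set.Ioi_inter_Iic, ← ofReal_integral_eq_lintegral_ofReal,
          ← intervalIntegral.integral_of_le hr.le, integral_pow]
        · simp
        · exact (intervalIntegrable_iff_integrableOn_Ioc_of_le hr.le).1
            ((continuous_pow d).intervalIntegrable _ _)
        · filter_upwards [ae_restrict_mem measurableSet_Ioc] with s hs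
          exact pow_nonneg hs.1.le _
      rw [hset hr.le, Complex.volume_sum_rpow_le ι (by norm_num), hd, hint,
        ← ENNReal.ofReal_pow (by positivity), ← ENNReal.ofReal_mul (by positivity),
        ← ENNReal.ofReal_mul (by positivity), pow_mul, Real.sq_sqrt hr.le]
      congr 1
      have h3 : (2 : ℝ) / 2 + 1 = (1 : ℕ) + 1 := by norm_num
      have h4 : (2 : ℝ) * ((d + 1 : ℕ) : ℝ) / 2 + 1 = (d + 1 : ℕ) + 1 := by ring
      rw [h3, h4, Gamma_nat_eq_factorial]
      push_cast
      rw [Gamma_add_one (s := (d + 1 : ℝ)) (by positivity)]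
      have : Gamma (d + 1 : ℝ) ≠ 0 := (Gamma_pos_of_pos (by positivity)).ne'
      simp
      field_simp
  have hmap : (volume : Measure (ι → ℂ)).map (fun y => ∑ i, ‖y i‖ ^ 2) =
      ENNReal.ofReal (π ^ (d + 1) / Gamma (d + 1 : ℕ)) •
        (volume.restrict (Set.Ioi 0)).withDensity fun s => ENNReal.ofReal (s ^ d) := by
    have key (r : ℝ) : (volume : Measure (ι → ℂ)).map (fun y => ∑ i, ‖y i‖ ^ 2) (Set.Iic r) =
      (ENNReal.ofReal (π ^ (d + 1) / Gamma (d + 1 : ℕ)) •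
        (volume.restrict (Set.Ioi 0)).withDensity fun s => ENNReal.ofReal (s ^ d)) (Set.Iic r) := by
      rw [Measure.map_apply hmeas measurableSet_Iic, Measure.smul_apply,
        withDensity_apply _ measurableSet_Iic, Measure.restrict_restrict measurableSet_Iic]
      exact hball r
    refine Measure.ext_of_generateFrom_of_iUnion (Set.range Set.Iic) (fun N : ℕ => Set.Iic (N : ℝ))
      (BorelSpace.measurable_eq.trans (borel_eq_generateFrom_Iic ℝ)) isPiSystem_Iic ?_ ?_ ?_ ?_
    · refine Set.eq_univ_of_forall fun x => Set.mem_iUnion.2 ?_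
      exact exists_nat_ge x
    · exact fun i => ⟨i, rfl⟩
    · intro i
      rw [Measure.map_apply hmeas measurableSet_Iic]
      change volume {y : ι → ℂ | ∑ i, ‖y i‖ ^ 2 ≤ (i : ℝ)} ≠ ⊤
      rw [hset (Nat.cast_nonneg i), Complex.volume_sum_rpow_le ι (by norm_num)]
      exact ENNReal.mul_ne_top (by simp) (by simp)
    · rintro _ ⟨r, rfl⟩
      exact key r
  rw [← lintegral_map hφ hmeas, hmap, lintegral_smul_measure, smul_eq_mul,
    lintegral_withDensity_eq_lintegral_mul _ hmeas' hφ, hd]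
  simp only [Pi.mul_apply, Nat.add_sub_cancel, mul_comm (φ _)]

theorem lintegral_comp_mulVec {ι : Type*} [Fintype ι] [DecidableEq ι] {M : Matrix ι ι ℂ}
    (hM : M.det ≠ 0) {F : (ι → ℂ) → ENNReal} (hF : Measurable F) :
    ∫⁻ x, F (M *ᵥ x) = ENNReal.ofReal (‖M.det‖ ^ 2)⁻¹ * ∫⁻ y, F y := by
  let L : (ι → ℂ) →ₗ[ℝ] (ι → ℂ) := M.toLin'.restrictScalars ℝ
  have hdet : LinearMap.det L = ‖M.det‖ ^ 2 := by
    rw [LinearMap.det_restrictScalars, LinearMap.det_toLin', Algebra.norm_complex_apply,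
      Complex.normSq_eq_norm_sq]
  have hL : LinearMap.det L ≠ 0 := by rw [hdet]; positivity
  have hmeas : Measurable L := L.continuous_of_finiteDimensional.measurable
  have := Measure.map_linearMap_addHaar_eq_smul_addHaar (volume : Measure (ι → ℂ)) hL
  change ∫⁻ x, F (L x) = _
  rw [← lintegral_map hF hmeas, this, lintegral_smul_measure, hdet, smul_eq_mul,
    abs_of_nonneg (by positivity)]

/-- There are `n - k` orthonormal vectors orthogonal to the `k` columns of `X`. -/
theorem exists_orthonormal_complement {n k d : ℕ} (h : k + d = n) (X : Matrix (Fin n) (Fin k) ℂ) :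
    ∃ N : Matrix (Fin n) (Fin d) ℂ, Nᴴ * N = 1 ∧ Xᴴ * N = 0 := by
  let v : Fin k → EuclideanSpace ℂ (Fin n) := fun j => WithLp.toLp 2 (X.col j)
  let W := Submodule.span ℂ (Set.range v)
  have hW : Module.finrank ℂ W ≤ k := by
    simpa [Set.finrank] using finrank_range_le_card (R := ℂ) v
  have hd : d ≤ Module.finrank ℂ Wᗮ := by
    have := W.finrank_add_finrank_orthogonal
    rw [finrank_euclideanSpace_fin] at this
    omega
  let e := stdOrthonormalBasis ℂ Wᗮ
  refine ⟨Matrix.of fun i j => (e (Fin.castLE hd j) : EuclideanSpace ℂ (Fin n)) i, ?_, ?_⟩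
  · ext i j
    have h1 := orthonormal_iff_ite.1 e.orthonormal (Fin.castLE hd i) (Fin.castLE hd j)
    rw [Submodule.coe_inner, PiLp.inner_apply] at h1
    simp only [Matrix.mul_apply, conjTranspose_apply, of_apply, Matrix.one_apply]
    simpa [mul_comm] using h1
  · ext i j
    have h1 := (Submodule.mem_orthogonal W _).1 (e (Fin.castLE hd j)).2 (v i)
      (Submodule.subset_span ⟨i, rfl⟩)
    rw [PiLp.inner_apply] at h1
    simp only [Matrix.mul_apply, conjTranspose_apply, of_apply, Matrix.zero_apply]
    simpa [mul_comm, v] using h1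

/-- The Hermitian matrix obtained from `G` by appending the column `b` and the diagonal entry
`t`. -/
def borderedMatrix {k : ℕ} (G : Matrix (Fin k) (Fin k) ℂ) (b : Fin k → ℂ) (t : ℝ) :
    Matrix (Fin (k + 1)) (Fin (k + 1)) ℂ :=
  (fromBlocks G (replicateCol (Fin 1) b) (replicateCol (Fin 1) b)ᴴ
    (of fun _ _ => (t : ℂ))).submatrix finSumFinEquiv.symm finSumFinEquiv.symm

theorem ofReal_re_dotProduct_inv {k : ℕ} {G : Matrix (Fin k) (Fin k) ℂ} (hG : G.PosDef)
    (b : Fin k → ℂ) : (((star b ⬝ᵥ G⁻¹ *ᵥ b).re : ℝ) : ℂ) = star b ⬝ᵥ G⁻¹ *ᵥ b := by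
  have h := hG.inv.posSemidef.dotProduct_mulVec_nonneg b
  exact Complex.ext rfl (Complex.le_def.1 h).2

theorem conjTranspose_replicateCol_mul_mul {k : ℕ} (A : Matrix (Fin k) (Fin k) ℂ)
    (b : Fin k → ℂ) :
    (replicateCol (Fin 1) b)ᴴ * A * replicateCol (Fin 1) b =
      of fun _ _ => star b ⬝ᵥ A *ᵥ b := by
  ext i j
  rw [Matrix.mul_assoc, ← replicateCol_mulVec]
  simp [Matrix.mul_apply, dotProduct]

theorem det_borderedMatrix {k : ℕ} {G : Matrix (Fin k) (Fin k) ℂ} (hG : G.PosDef)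
    (b : Fin k → ℂ) (t : ℝ) :
    (borderedMatrix G b t).det = G.det * ((t - (star b ⬝ᵥ G⁻¹ *ᵥ b).re : ℝ) : ℂ) := by
  have := hG.isUnit.invertible
  rw [borderedMatrix, det_submatrix_equiv_self, det_fromBlocks₁₁, invOf_eq_nonsing_inv,
    conjTranspose_replicateCol_mul_mul, det_unique (n := Fin 1)]
  push_cast
  rw [ofReal_re_dotProduct_inv hG]
  simp

theorem borderedMatrix_posDef_iff {k : ℕ} {G : Matrix (Fin k) (Fin k) ℂ} (hG : G.PosDef)
    (b : Fin k → ℂ) (t : ℝ) :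
    (borderedMatrix G b t).PosDef ↔ 0 < t - (star b ⬝ᵥ G⁻¹ *ᵥ b).re := by
  have := hG.isUnit.invertible
  have hpsd : (borderedMatrix G b t).PosSemidef ↔ 0 ≤ t - (star b ⬝ᵥ G⁻¹ *ᵥ b).re := by
    rw [borderedMatrix, posSemidef_submatrix_equiv, PosDef.fromBlocks₁₁ _ _ hG,
      conjTranspose_replicateCol_mul_mul, ← ofReal_re_dotProduct_inv hG b]
    have h1 : (of fun _ _ => (t : ℂ)) - (of fun _ _ => (((star b ⬝ᵥ G⁻¹ *ᵥ b).re : ℝ) : ℂ)) =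
        diagonal fun _ : Fin 1 => ((t - (star b ⬝ᵥ G⁻¹ *ᵥ b).re : ℝ) : ℂ) := by
      ext i j
      simp [Subsingleton.elim i j]
    rw [h1, posSemidef_diagonal_iff]
    simp only [Complex.zero_le_real, forall_const, Complex.ofReal_re]
  have hdet := det_borderedMatrix hG b t
  constructor
  · intro h
    refine lt_of_le_of_ne (hpsd.1 h.posSemidef) fun h0 => ?_
    rw [← h0] at hdet
    exact h.det_pos.ne' (by simpa using hdet)
  · intro h
    rw [(hpsd.2 h.le).posDef_iff_det_ne_zero, hdet]
    exact mul_ne_zero hG.det_pos.ne' (Complex.ofReal_ne_zero.2 h.ne')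

theorem posDef_of_borderedMatrix {k : ℕ} {G : Matrix (Fin k) (Fin k) ℂ} {b : Fin k → ℂ} {t : ℝ}
    (h : (borderedMatrix G b t).PosDef) : G.PosDef := by
  have := h.submatrix (e := Fin.castAdd 1) (Fin.castAdd_injective k 1)
  convert this
  ext i j
  simp [borderedMatrix]

theorem sum_norm_sq_eq_dotProduct {ι : Type*} [Fintype ι] (x : ι → ℂ) :
    ((∑ i, ‖x i‖ ^ 2 : ℝ) : ℂ) = star x ⬝ᵥ x := by
  simp [dotProduct, Complex.conj_mul']

theorem dotProduct_eq_dotProduct_mulVec {ι : Type*} [Fintype ι] [DecidableEq ι]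
    {A : Matrix ι ι ℂ} (hA : A.det ≠ 0) (w : ι → ℂ) :
    star w ⬝ᵥ w = star (A *ᵥ w) ⬝ᵥ (A * Aᴴ)⁻¹ *ᵥ (A *ᵥ w) := by
  have hA' : IsUnit A.det := isUnit_iff_ne_zero.2 hA
  have hA'' : IsUnit Aᴴ.det := by rw [det_conjTranspose]; exact hA'.star
  rw [star_mulVec, ← dotProduct_mulVec, mulVec_mulVec, mulVec_mulVec, Matrix.mul_inv_rev,
    Matrix.mul_assoc, Matrix.mul_assoc,
    nonsing_inv_mul _ hA', Matrix.mul_one, mul_nonsing_inv _ hA'', one_mulVec]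

theorem lintegral_mulVec_sum_norm_sq {n k d : ℕ} [NeZero d] (hn : k + d = n)
    (X : Matrix (Fin n) (Fin k) ℂ) (hX : (Xᴴ * X).det ≠ 0) {h : (Fin k → ℂ) → ℝ → ENNReal}
    (hh : Measurable (Function.uncurry h)) :
    ∫⁻ x : Fin n → ℂ, h (Xᴴ *ᵥ x) (∑ i, ‖x i‖ ^ 2) =
      ENNReal.ofReal (π ^ d / Gamma d) * (ENNReal.ofReal ((Xᴴ * X).det.re)⁻¹ *
        ∫⁻ b : Fin k → ℂ, ∫⁻ s in Set.Ioi (0 : ℝ),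
          h b ((star b ⬝ᵥ (Xᴴ * X)⁻¹ *ᵥ b).re + s) * ENNReal.ofReal (s ^ (d - 1))) := by
  obtain ⟨N, hNN, hXN⟩ := exists_orthonormal_complement hn X
  have hNX : Nᴴ * X = 0 := by
    simpa using congrArg conjTranspose hXN
  set G := Xᴴ * X with hGdef
  have hGpsd : G.PosSemidef := posSemidef_conjTranspose_mul_self X
  have hG : G.PosDef := hGpsd.posDef_iff_det_ne_zero.2 hX
  let e : Fin k ⊕ Fin d ≃ Fin n := finSumFinEquiv.trans (finCongr hn)
  let A : Matrix (Fin k ⊕ Fin d) (Fin k ⊕ Fin d) ℂ := (fromCols X N)ᴴ.submatrix id e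
  have hAA : A * Aᴴ = fromBlocks G 0 0 1 := by
    rw [conjTranspose_submatrix, submatrix_mul_equiv, conjTranspose_conjTranspose, submatrix_id_id,
      conjTranspose_fromCols_eq_fromRows_conjTranspose, fromRows_mul_fromCols, hNN, hXN, hNX]
  have hdetA : ‖A.det‖ ^ 2 = G.det.re := by
    have h1 := congrArg det hAA
    rw [det_mul, det_conjTranspose, det_fromBlocks_zero₂₁, det_one, mul_one] at h1
    rw [← h1, ← Complex.ofReal_re (‖A.det‖ ^ 2)]
    congr 1
    simpa using (Complex.mul_conj' A.det).symm
  have hA : A.det ≠ 0 := by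
    intro h0
    have : G.det.re = 0 := by rw [← hdetA, h0]; simp
    exact hG.det_pos.ne' (Complex.ext this (Complex.lt_def.1 hG.det_pos).2.symm)
  have hinv : (A * Aᴴ)⁻¹ = fromBlocks G⁻¹ 0 0 1 := by
    refine inv_eq_right_inv ?_
    rw [hAA, fromBlocks_multiply, mul_nonsing_inv _ (isUnit_iff_ne_zero.2 hX)]
    simp
  have hAw (w : Fin k ⊕ Fin d → ℂ) :
      A *ᵥ w = Sum.elim (Xᴴ *ᵥ (w ∘ e.symm)) (Nᴴ *ᵥ (w ∘ e.symm)) := by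
    simp only [A, submatrix_mulVec_equiv, conjTranspose_fromCols_eq_fromRows_conjTranspose,
      fromRows_mulVec, Function.comp_id]
  let F : (Fin k ⊕ Fin d → ℂ) → ENNReal := fun z =>
    h (z ∘ Sum.inl) ((star (z ∘ Sum.inl) ⬝ᵥ G⁻¹ *ᵥ (z ∘ Sum.inl)).re + ∑ i, ‖z (Sum.inr i)‖ ^ 2)
  have hq : Measurable fun b : Fin k → ℂ => (star b ⬝ᵥ G⁻¹ *ᵥ b).re := by
    refine (Complex.continuous_re.comp ?_).measurable
    exact continuous_star.dotProduct (Continuous.matrix_mulVec continuous_const continuous_id)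
  let F' : (Fin k → ℂ) × (Fin d → ℂ) → ENNReal := fun p =>
    h p.1 ((star p.1 ⬝ᵥ G⁻¹ *ᵥ p.1).re + ∑ i, ‖p.2 i‖ ^ 2)
  have hF' : Measurable F' := by
    refine hh.comp (measurable_fst.prodMk ((hq.comp measurable_fst).add ?_))
    fun_prop
  have hsum := volume_measurePreserving_sumPiEquivProdPi fun _ : Fin k ⊕ Fin d => ℂ
  have hFF' (z) : F z = F' (MeasurableEquiv.sumPiEquivProdPi (fun _ => ℂ) z) := rfl
  have hF : Measurable F := hF'.comp hsum.measurable
  have hF_mulVec (w : Fin k ⊕ Fin d → ℂ) :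
      F (A *ᵥ w) = h (Xᴴ *ᵥ (w ∘ e.symm)) (∑ i, ‖(w ∘ e.symm) i‖ ^ 2) := by
    simp only [F]
    have h1 : (A *ᵥ w) ∘ Sum.inl = Xᴴ *ᵥ (w ∘ e.symm) := by rw [hAw]; rfl
    have h2 : star w ⬝ᵥ w = star ((A *ᵥ w) ∘ Sum.inl) ⬝ᵥ G⁻¹ *ᵥ ((A *ᵥ w) ∘ Sum.inl) +
        star ((A *ᵥ w) ∘ Sum.inr) ⬝ᵥ ((A *ᵥ w) ∘ Sum.inr) := by
      rw [dotProduct_eq_dotProduct_mulVec hA, hinv, fromBlocks_mulVec]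
      simp [dotProduct]
    have h3 : ∑ i, ‖(w ∘ e.symm) i‖ ^ 2 = ∑ i, ‖w i‖ ^ 2 :=
      e.symm.sum_comp fun i => ‖w i‖ ^ 2
    rw [h3, ← Complex.ofReal_re (∑ i, ‖w i‖ ^ 2), sum_norm_sq_eq_dotProduct, h2, Complex.add_re,
      ← sum_norm_sq_eq_dotProduct, Complex.ofReal_re, h1]
    rfl
  have he := (volume_measurePreserving_piCongrLeft (fun _ : Fin n => ℂ) e)
  calc ∫⁻ x : Fin n → ℂ, h (Xᴴ *ᵥ x) (∑ i, ‖x i‖ ^ 2)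
      = ∫⁻ w, F (A *ᵥ w) := by
        rw [← he.lintegral_comp_emb (MeasurableEquiv.measurableEmbedding _)]
        refine lintegral_congr fun w => ?_
        rw [hF_mulVec]
        have : MeasurableEquiv.piCongrLeft (fun _ : Fin n => ℂ) e w = w ∘ e.symm := by
          ext i
          obtain ⟨j, rfl⟩ := e.surjective i
          rw [MeasurableEquiv.coe_piCongrLeft, Equiv.piCongrLeft_apply_apply]
          simp
        rw [this]
    _ = ENNReal.ofReal (G.det.re)⁻¹ * ∫⁻ p, F' p := by
        rw [lintegral_comp_mulVec hA hF, hdetA,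
          ← hsum.lintegral_comp_emb (MeasurableEquiv.measurableEmbedding _)]
        rfl
    _ = ENNReal.ofReal (G.det.re)⁻¹ * ∫⁻ b, ENNReal.ofReal (π ^ d / Gamma d) *
          ∫⁻ s in Set.Ioi (0 : ℝ),
            h b ((star b ⬝ᵥ G⁻¹ *ᵥ b).re + s) * ENNReal.ofReal (s ^ (d - 1)) := by
        rw [Measure.volume_eq_prod, lintegral_prod _ hF'.aemeasurable]
        congr 1
        refine lintegral_congr fun b => ?_
        have hφ : Measurable fun s => h b ((star b ⬝ᵥ G⁻¹ *ᵥ b).re + s) :=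
          hh.comp (measurable_const.prodMk (measurable_const.add measurable_id))
        simpa using lintegral_comp_sum_norm_sq (ι := Fin d) hφ
    _ = _ := by
        rw [lintegral_const_mul' _ _ ENNReal.ofReal_ne_top, mul_left_comm]

/-- For fixed `X` of full column rank, the integral over an appended column `x` of a function of
the Gram matrix of `(X, x)`. -/
theorem lintegral_borderedMatrix_gram {n k d : ℕ} [NeZero d] (hn : k + d = n)
    (X : Matrix (Fin n) (Fin k) ℂ) (hX : (Xᴴ * X).det ≠ 0)
    {f : Matrix (Fin (k + 1)) (Fin (k + 1)) ℂ → ENNReal} (hf : Measurable f) :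
    ∫⁻ x : Fin n → ℂ, f (borderedMatrix (Xᴴ * X) (Xᴴ *ᵥ x) (∑ i, ‖x i‖ ^ 2)) =
      ENNReal.ofReal (π ^ d / Gamma d) * (ENNReal.ofReal ((Xᴴ * X).det.re)⁻¹ *
        ∫⁻ b : Fin k → ℂ, ∫⁻ t : ℝ,
          {S : Matrix (Fin (k + 1)) (Fin (k + 1)) ℂ | S.PosDef}.indicator f
            (borderedMatrix (Xᴴ * X) b t) *
          ENNReal.ofReal (((borderedMatrix (Xᴴ * X) b t).det.re / (Xᴴ * X).det.re) ^ (d - 1))) := by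
  have hG : (Xᴴ * X).PosDef := (posSemidef_conjTranspose_mul_self X).posDef_iff_det_ne_zero.2 hX
  have hdet : (Xᴴ * X).det.re ≠ 0 := (Complex.lt_def.1 hG.det_pos).1.ne'
  have hmeas : Measurable (Function.uncurry fun b t => f (borderedMatrix (Xᴴ * X) b t)) := by
    refine hf.comp (measurable_pi_lambda _ fun i => measurable_pi_lambda _ fun j => ?_)
    simp only [borderedMatrix, submatrix_apply]
    rcases finSumFinEquiv.symm i with i | i <;> rcases finSumFinEquiv.symm j with j | j <;>
    simp <;> fun_prop
  rw [lintegral_mulVec_sum_norm_sq hn X hX hmeas]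
  congr 2
  refine lintegral_congr fun b => ?_
  rw [← lintegral_indicator measurableSet_Ioi]
  refine Eq.trans ?_ (lintegral_add_left_eq_self _ (star b ⬝ᵥ (Xᴴ * X)⁻¹ *ᵥ b).re)
  refine lintegral_congr fun s => ?_
  rw [det_borderedMatrix hG, Complex.re_mul_ofReal, mul_div_cancel_left₀ _ hdet,
    add_sub_cancel_left]
  by_cases hs : 0 < s
  · rw [Set.indicator_of_mem (show s ∈ Set.Ioi 0 from hs), Set.indicator_of_mem]
    simpa [borderedMatrix_posDef_iff hG] using hs
  · rw [Set.indicator_of_notMem (show s ∉ Set.Ioi 0 from hs), Set.indicator_of_notMem, zero_mul]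
    simpa [borderedMatrix_posDef_iff hG] using hs

instance matBorelSpace {n m : ℕ} : BorelSpace (Matrix (Fin n) (Fin m) ℂ) :=
  inferInstanceAs (BorelSpace (Fin n → Fin m → ℂ))

instance matSigmaFinite {n m : ℕ} : SigmaFinite (volume : Measure (Matrix (Fin n) (Fin m) ℂ)) :=
  inferInstanceAs (SigmaFinite (volume : Measure (Fin n → Fin m → ℂ)))

theorem measurableSet_posDef (m : ℕ) :
    MeasurableSet {S : Matrix (Fin m) (Fin m) ℂ | S.PosDef} := by
  have h1 : {S : Matrix (Fin m) (Fin m) ℂ | S.PosDef} =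
      {S | Sᴴ = S} ∩ (⋂ x : Fin m → ℂ, {S | 0 ≤ star x ⬝ᵥ S *ᵥ x}) ∩ {S | S.det = 0}ᶜ := by
    ext S
    simp only [Set.mem_inter_iff, Set.mem_iInter, Set.mem_ofPred_eq, Set.mem_compl_iff]
    constructor
    · exact fun h => ⟨⟨h.1, h.posSemidef.dotProduct_mulVec_nonneg⟩, h.det_pos.ne'⟩
    · rintro ⟨⟨h, h'⟩, h''⟩
      exact (PosSemidef.of_dotProduct_mulVec_nonneg h h').posDef_iff_det_ne_zero.2 h''
  rw [h1]
  refine ((IsClosed.inter (isClosed_eq ?_ ?_) (isClosed_iInter fun x => ?_)).measurableSet).inter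
    (isClosed_eq ?_ ?_).measurableSet.compl
  · exact continuous_id.matrix_conjTranspose
  · exact continuous_id
  · exact isClosed_le continuous_const
      (continuous_const.dotProduct (continuous_id.matrix_mulVec continuous_const))
  · exact continuous_id.matrix_det
  · exact continuous_const

theorem continuous_borderedMatrix {k : ℕ} :
    Continuous fun p : Matrix (Fin k) (Fin k) ℂ × (Fin k → ℂ) × ℝ =>
      borderedMatrix p.1 p.2.1 p.2.2 := by
  refine continuous_matrix fun i j => ?_
  simp only [borderedMatrix, submatrix_apply]
  rcases finSumFinEquiv.symm i with i | i <;> rcases finSumFinEquiv.symm j with j | j <;>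
  simp <;> fun_prop

/-- The Hermitian matrix with given above-diagonal and diagonal entries. -/
def hermMatrix {m : ℕ} (fd : ({p : Fin m × Fin m // p.1 < p.2} → ℂ) × (Fin m → ℝ)) :
    Matrix (Fin m) (Fin m) ℂ :=
  Matrix.of fun i j =>
    if h : i < j then fd.1 ⟨(i, j), h⟩
    else if h' : j < i then star (fd.1 ⟨(j, i), h'⟩)
    else (fd.2 i : ℂ)

theorem measurable_hermMatrix {m : ℕ} : Measurable (hermMatrix (m := m)) := by
  refine measurable_pi_lambda _ fun i => measurable_pi_lambda _ fun j => ?_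
  simp only [hermMatrix, of_apply]
  split_ifs
  · fun_prop
  · exact continuous_star.measurable.comp (by fun_prop)
  · fun_prop

theorem lintegral_hermMeasure {m : ℕ} {g : Matrix (Fin m) (Fin m) ℂ → ENNReal}
    (hg : Measurable g) : ∫⁻ S, g S ∂(hermMeasure m) = ∫⁻ fd, g (hermMatrix fd) :=
  lintegral_map hg measurable_hermMatrix

/-- An above-diagonal position in a matrix of size `k + 1` is an above-diagonal position in the
leading block of size `k` or an entry of the last column. -/
noncomputable def upperIndexEquiv (k : ℕ) :
    {p : Fin k × Fin k // p.1 < p.2} ⊕ Fin k ≃ {p : Fin (k + 1) × Fin (k + 1) // p.1 < p.2} :=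
  Equiv.ofBijective
    (Sum.elim (fun p => ⟨(p.1.1.castSucc, p.1.2.castSucc), Fin.castSucc_lt_castSucc_iff.2 p.2⟩)
      fun i => ⟨(i.castSucc, Fin.last k), Fin.castSucc_lt_last i⟩) <| by
    constructor
    · rintro (⟨⟨a, b⟩, h⟩ | a) (⟨⟨a', b'⟩, h'⟩ | a') H
      · simpa using H
      · simp [Fin.ext_iff] at H; omega
      · simp [Fin.ext_iff] at H; omega
      · simpa using H
    · rintro ⟨⟨a, b⟩, h⟩
      have ha : a ≠ Fin.last k := (lt_of_lt_of_le h (Fin.le_last b)).ne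
      obtain ⟨a, rfl⟩ := Fin.exists_castSucc_eq.2 ha
      by_cases hb : b = Fin.last k
      · subst hb
        exact ⟨Sum.inr a, rfl⟩
      · obtain ⟨b, rfl⟩ := Fin.exists_castSucc_eq.2 hb
        exact ⟨Sum.inl ⟨(a, b), Fin.castSucc_lt_castSucc_iff.1 h⟩, rfl⟩

theorem hermMatrix_succ {k : ℕ} (w : {p : Fin (k + 1) × Fin (k + 1) // p.1 < p.2} → ℂ)
    (v : Fin (k + 1) → ℝ) :
    hermMatrix (w, v) = borderedMatrix
      (hermMatrix (fun p => w (upperIndexEquiv k (Sum.inl p)), fun i => v i.castSucc))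
      (fun i => w (upperIndexEquiv k (Sum.inr i))) (v (Fin.last k)) := by
  have hlast : finSumFinEquiv.symm (Fin.last k) = Sum.inr (0 : Fin 1) := by
    rw [Equiv.symm_apply_eq]; rfl
  have hcast (i : Fin k) : finSumFinEquiv.symm i.castSucc = (Sum.inl i : Fin k ⊕ Fin 1) := by
    rw [Equiv.symm_apply_eq]; rfl
  have hinl (p : {p : Fin k × Fin k // p.1 < p.2}) : upperIndexEquiv k (Sum.inl p) =
      ⟨(p.1.1.castSucc, p.1.2.castSucc), Fin.castSucc_lt_castSucc_iff.2 p.2⟩ := rfl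
  have hinr (i : Fin k) : upperIndexEquiv k (Sum.inr i) =
      ⟨(i.castSucc, Fin.last k), Fin.castSucc_lt_last i⟩ := rfl
  ext i j
  refine Fin.lastCases ?_ (fun i => ?_) i <;> refine Fin.lastCases ?_ (fun j => ?_) j
  · simp [borderedMatrix, hermMatrix, hlast]
  · simp [borderedMatrix, hermMatrix, hlast, hcast, hinr, Fin.castSucc_lt_last,
      (Fin.castSucc_lt_last j).not_gt]
  · simp [borderedMatrix, hermMatrix, hlast, hcast, hinr, Fin.castSucc_lt_last]
  · simp [borderedMatrix, hermMatrix, hcast, hinl]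

theorem measurePreserving_upperIndexEquiv (k : ℕ) : MeasurePreserving
    (fun w : {p : Fin (k + 1) × Fin (k + 1) // p.1 < p.2} → ℂ =>
    ((fun p => w (upperIndexEquiv k (Sum.inl p)), fun i => w (upperIndexEquiv k (Sum.inr i))) :
      ({p : Fin k × Fin k // p.1 < p.2} → ℂ) × (Fin k → ℂ))) volume volume :=
  (volume_measurePreserving_sumPiEquivProdPi
    fun _ : {p : Fin k × Fin k // p.1 < p.2} ⊕ Fin k => ℂ).comp
  ((volume_measurePreserving_piCongrLeft (fun _ => ℂ) (upperIndexEquiv k)).symm)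

theorem measurePreserving_last_init (k : ℕ) : MeasurePreserving
    (fun v : Fin (k + 1) → ℝ => (v (Fin.last k), fun i : Fin k => v i.castSucc)) volume volume := by
  have h := volume_preserving_piFinSuccAbove (fun _ : Fin (k + 1) => ℝ) (Fin.last k)
  have h' : (fun v : Fin (k + 1) → ℝ => (v (Fin.last k), fun i : Fin k => v i.castSucc)) =
      MeasurableEquiv.piFinSuccAbove (fun _ : Fin (k + 1) => ℝ) (Fin.last k) := by
    funext v
    simp [MeasurableEquiv.piFinSuccAbove, Fin.insertNthEquiv]
    rfl
  rw [h']
  exact h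

/-- Tonelli for a product of two products, integrating the two middle factors first. -/
theorem lintegral_prod_prod_rearrange {α β γ δ : Type*} [MeasurableSpace α] [MeasurableSpace β]
    [MeasurableSpace γ] [MeasurableSpace δ] {μ : Measure α} {ν : Measure β} {ρ : Measure γ}
    {σ : Measure δ} [SFinite μ] [SFinite ν] [SFinite ρ] [SFinite σ]
    {H : (α × β) × (γ × δ) → ENNReal} (hH : Measurable H) :
    ∫⁻ q, H q ∂((μ.prod ν).prod (ρ.prod σ)) =
      ∫⁻ p, ∫⁻ b, ∫⁻ t, H ((p.1, b), (t, p.2)) ∂ρ ∂ν ∂(μ.prod σ) := by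
  have hHt : Measurable fun p : (α × δ) × β => ∫⁻ t, H ((p.1.1, p.2), (t, p.1.2)) ∂ρ :=
    Measurable.lintegral_prod_right' (f := fun q : ((α × δ) × β) × γ =>
      H ((q.1.1.1, q.1.2), (q.2, q.1.1.2))) (hH.comp (by fun_prop))
  rw [lintegral_prod _ hH.aemeasurable, lintegral_prod _ hH.lintegral_prod_right'.aemeasurable,
    lintegral_prod _ hHt.lintegral_prod_right'.aemeasurable]
  refine lintegral_congr fun u => ?_
  calc ∫⁻ b, ∫⁻ y, H ((u, b), y) ∂(ρ.prod σ) ∂ν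
      = ∫⁻ b, ∫⁻ v, ∫⁻ t, H ((u, b), (t, v)) ∂ρ ∂σ ∂ν :=
        lintegral_congr fun b =>
          lintegral_prod_symm' (fun y => H ((u, b), y)) (hH.comp (by fun_prop))
    _ = _ := lintegral_lintegral_swap (Measurable.aemeasurable
        (hHt.comp (f := fun p : β × δ => ((u, p.2), p.1)) (by fun_prop)))

/-- Fubini for Hermitian matrices: split off the last row and column. -/
theorem lintegral_hermMeasure_succ {k : ℕ}
    {g : Matrix (Fin (k + 1)) (Fin (k + 1)) ℂ → ENNReal} (hg : Measurable g) :
    ∫⁻ S, g S ∂(hermMeasure (k + 1)) =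
      ∫⁻ G, (∫⁻ b, ∫⁻ t, g (borderedMatrix G b t)) ∂(hermMeasure k) := by
  have hgb : Measurable fun p : (Matrix (Fin k) (Fin k) ℂ × (Fin k → ℂ)) × ℝ =>
      g (borderedMatrix p.1.1 p.1.2 p.2) :=
    hg.comp (continuous_borderedMatrix.measurable.comp MeasurableEquiv.prodAssoc.measurable)
  have hgb' := hgb.lintegral_prod_right' (ν := volume)
  have hgb'' := hgb'.lintegral_prod_right' (ν := volume)
  let H : (({p : Fin k × Fin k // p.1 < p.2} → ℂ) × (Fin k → ℂ)) × (ℝ × (Fin k → ℝ)) → ENNReal :=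
    fun q => g (borderedMatrix (hermMatrix (q.1.1, q.2.2)) q.1.2 q.2.1)
  have hH : Measurable H := by
    refine hgb.comp (((measurable_hermMatrix.comp ?_).prodMk ?_).prodMk ?_) <;> fun_prop
  have hmp := (measurePreserving_upperIndexEquiv k).prod (measurePreserving_last_init k)
  rw [lintegral_hermMeasure hg, lintegral_hermMeasure hgb'']
  refine Eq.trans ?_ ((hmp.lintegral_comp hH).trans (lintegral_prod_prod_rearrange
    (μ := volume) (ν := volume) (ρ := volume) (σ := volume) hH))
  refine lintegral_congr fun fd => ?_
  exact congrArg g (hermMatrix_succ fd.1 fd.2)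

theorem conjTranspose_mul_self_succ {n k : ℕ} (X : Matrix (Fin n) (Fin (k + 1)) ℂ) :
    Xᴴ * X = borderedMatrix
      ((X.submatrix id Fin.castSucc)ᴴ * X.submatrix id Fin.castSucc)
      ((X.submatrix id Fin.castSucc)ᴴ *ᵥ X.col (Fin.last k)) (∑ i, ‖X i (Fin.last k)‖ ^ 2) := by
  have hlast : finSumFinEquiv.symm (Fin.last k) = Sum.inr (0 : Fin 1) := by
    rw [Equiv.symm_apply_eq]; rfl
  have hcast (i : Fin k) : finSumFinEquiv.symm i.castSucc = (Sum.inl i : Fin k ⊕ Fin 1) := by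
    rw [Equiv.symm_apply_eq]; rfl
  ext i j
  refine Fin.lastCases ?_ (fun i => ?_) i <;> refine Fin.lastCases ?_ (fun j => ?_) j
  · simp [borderedMatrix, hlast, Matrix.mul_apply, Complex.conj_mul']
  · simp [borderedMatrix, hlast, hcast, Matrix.mul_apply, mulVec, dotProduct, mul_comm]
  · simp [borderedMatrix, hlast, hcast, Matrix.mul_apply, mulVec, dotProduct]
  · simp [borderedMatrix, hcast, Matrix.mul_apply]

theorem lintegral_conjTranspose_mul_self_succ {n k : ℕ}
    {f : Matrix (Fin (k + 1)) (Fin (k + 1)) ℂ → ENNReal} (hf : Measurable f) :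
    ∫⁻ X : Matrix (Fin n) (Fin (k + 1)) ℂ, f (Xᴴ * X) =
      ∫⁻ Y : Matrix (Fin n) (Fin k) ℂ, ∫⁻ x : Fin n → ℂ,
        f (borderedMatrix (Yᴴ * Y) (Yᴴ *ᵥ x) (∑ i, ‖x i‖ ^ 2)) := by
  let H : (Fin n → ℂ) × Matrix (Fin n) (Fin k) ℂ → ENNReal := fun q =>
    f (borderedMatrix (q.2ᴴ * q.2) (q.2ᴴ *ᵥ q.1) (∑ i, ‖q.1 i‖ ^ 2))
  have hH : Measurable H := by
    have h1 : Continuous fun q : (Fin n → ℂ) × Matrix (Fin n) (Fin k) ℂ => q.2ᴴ :=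
      continuous_snd.matrix_conjTranspose
    have h2 : Continuous fun q : (Fin n → ℂ) × Matrix (Fin n) (Fin k) ℂ => ∑ i, ‖q.1 i‖ ^ 2 := by
      fun_prop
    exact hf.comp (continuous_borderedMatrix.comp ((h1.matrix_mul continuous_snd).prodMk
      ((h1.matrix_mulVec continuous_fst).prodMk h2))).measurable
  have hmp : MeasurePreserving (fun X : Matrix (Fin n) (Fin (k + 1)) ℂ =>
      (X.col (Fin.last k), X.submatrix id Fin.castSucc)) volume volume := by
    have h := (volume_measurePreserving_arrowProdEquivProdArrow ℂ (Fin k → ℂ) (Fin n)).comp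
      (volume_preserving_pi fun _ : Fin n =>
        volume_preserving_piFinSuccAbove (fun _ : Fin (k + 1) => ℂ) (Fin.last k))
    have h' : (fun X : Matrix (Fin n) (Fin (k + 1)) ℂ =>
        (X.col (Fin.last k), X.submatrix id Fin.castSucc)) =
        fun X => MeasurableEquiv.arrowProdEquivProdArrow ℂ (Fin k → ℂ) (Fin n) fun i =>
          MeasurableEquiv.piFinSuccAbove (fun _ : Fin (k + 1) => ℂ) (Fin.last k) (X i) := by
      funext X
      simp [MeasurableEquiv.piFinSuccAbove, Fin.insertNthEquiv,
        MeasurableEquiv.arrowProdEquivProdArrow, Equiv.arrowProdEquivProdArrow]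
      rfl
    rw [h']
    exact h
  have h1 : ∫⁻ q, H q = ∫⁻ Y, ∫⁻ x, H (x, Y) := by
    rw [Measure.volume_eq_prod, lintegral_prod_symm' _ hH]
  refine Eq.trans ?_ h1
  rw [← hmp.lintegral_comp hH]
  exact lintegral_congr fun X => congrArg f (conjTranspose_mul_self_succ X)

theorem cmvGamma_succ (m : ℕ) (a : ℝ) :
    cmvGamma (m + 1) a = cmvGamma m a * (π ^ m * Gamma (a - m)) := by
  have h : ((m + 1 : ℕ) : ℝ) * (((m + 1 : ℕ) : ℝ) - 1) / 2 = (m : ℝ) * (m - 1) / 2 + m := by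
    push_cast; ring
  rw [cmvGamma, cmvGamma, Fin.prod_univ_castSucc, h, rpow_add pi_pos, rpow_natCast]
  simp only [Fin.val_castSucc, Fin.val_last]
  ring

theorem cmvGamma_pos {m : ℕ} {a : ℝ} (h : (m : ℝ) - 1 < a) : 0 < cmvGamma m a := by
  refine mul_pos (rpow_pos_of_pos pi_pos _) (Finset.prod_pos fun i _ => Gamma_pos_of_pos ?_)
  have : ((i : ℕ) : ℝ) + 1 ≤ m := by exact_mod_cast i.2
  linarith

theorem rpow_div_cmvGamma_succ {n k d : ℕ} (hn : k + d = n) (hd : 0 < d) :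
    π ^ (((k + 1 : ℕ) : ℝ) * n) / cmvGamma (k + 1) n =
      π ^ ((k : ℝ) * n) / cmvGamma k n * (π ^ d / Gamma d) := by
  have h1 : (n : ℝ) - k = d := by rw [← hn]; push_cast; ring
  have h2 : ((k + 1 : ℕ) : ℝ) * n = k * n + (k + d : ℕ) := by rw [hn]; push_cast; ring
  have hd' : (0 : ℝ) < d := by exact_mod_cast hd
  have h3 := (cmvGamma_pos (m := k) (a := n) (by linarith)).ne'
  have h4 := (Gamma_pos_of_pos hd').ne'
  rw [cmvGamma_succ, h1, h2, rpow_add pi_pos, rpow_natCast, pow_add]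
  field_simp

theorem hermMeasure_zero : hermMeasure 0 = Measure.dirac 0 := by
  have h : (volume : Measure (({p : Fin 0 × Fin 0 // p.1 < p.2} → ℂ) × (Fin 0 → ℝ))) =
      Measure.dirac default := by
    rw [Measure.volume_eq_prod, volume_pi, volume_pi, Measure.pi_of_empty _ default,
      Measure.pi_of_empty _ default, Measure.dirac_prod_dirac]
    rfl
  rw [hermMeasure, h]
  refine (Measure.map_dirac' measurable_hermMatrix _).trans ?_
  congr 1
  exact Subsingleton.elim _ _

theorem lintegral_conjTranspose_mul_self {n m : ℕ} (hnm : m ≤ n)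
    {f : Matrix (Fin m) (Fin m) ℂ → ENNReal} (hf : Measurable f) :
    ∫⁻ X : Matrix (Fin n) (Fin m) ℂ, f (Xᴴ * X) =
      ENNReal.ofReal (π ^ ((m : ℝ) * n) / cmvGamma m (n : ℝ)) *
        ∫⁻ S in {S : Matrix (Fin m) (Fin m) ℂ | S.PosDef},
          f S * ENNReal.ofReal (S.det.re ^ (n - m)) ∂(hermMeasure m) := by
  induction m with
  | zero =>
    have h0 : (volume : Measure (Matrix (Fin n) (Fin 0) ℂ)) = Measure.dirac 0 := by
      have h1 : IsProbabilityMeasure (volume : Measure (Fin 0 → ℂ)) := by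
        rw [Measure.volume_pi_eq_dirac 0]; infer_instance
      have h2 : (volume : Measure (Matrix (Fin n) (Fin 0) ℂ)) Set.univ = 1 :=
        measure_univ (μ := (volume : Measure (Fin n → Fin 0 → ℂ)))
      ext s hs
      obtain rfl | hs' := s.eq_empty_or_nonempty
      · simp
      · rw [Subsingleton.eq_univ_of_nonempty hs', h2, measure_univ]
    have hpd (S : Matrix (Fin 0) (Fin 0) ℂ) : S.PosDef := by
      rw [Subsingleton.elim S 1]; exact PosDef.one
    simp only [hpd, Set.ofPred_true, Measure.restrict_univ]
    rw [h0, hermMeasure_zero, lintegral_dirac, lintegral_dirac]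
    simp [cmvGamma, Subsingleton.elim (_ : Matrix (Fin 0) (Fin 0) ℂ) 0]
  | succ k ih =>
    obtain ⟨d, hn⟩ : ∃ d, k + d = n := ⟨n - k, by omega⟩
    have hd : 0 < d := by omega
    have : NeZero d := ⟨hd.ne'⟩
    have hkn : k ≤ n := by omega
    have hnk : n - k = d := by omega
    have hnk' : n - (k + 1) = d - 1 := by omega
    set P := {S : Matrix (Fin (k + 1)) (Fin (k + 1)) ℂ | S.PosDef}
    have hP : MeasurableSet P := measurableSet_posDef (k + 1)
    have hdet {m : ℕ} : Measurable fun S : Matrix (Fin m) (Fin m) ℂ => S.det.re :=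
      (Complex.continuous_re.comp continuous_id.matrix_det).measurable
    have hae : ∀ᵐ Y : Matrix (Fin n) (Fin k) ℂ, (Yᴴ * Y).det ≠ 0 := by
      have hZ : MeasurableSet {S : Matrix (Fin k) (Fin k) ℂ | S.det = 0} :=
        (isClosed_eq continuous_id.matrix_det continuous_const).measurableSet
      have hgram : Measurable fun Y : Matrix (Fin n) (Fin k) ℂ => Yᴴ * Y :=
        (continuous_id.matrix_conjTranspose.matrix_mul continuous_id).measurable
      have h := ih hkn (f := {S | S.det = 0}.indicator 1) (measurable_one.indicator hZ)
      have h0 : ∫⁻ S in {S : Matrix (Fin k) (Fin k) ℂ | S.PosDef},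
          {S | S.det = 0}.indicator 1 S * ENNReal.ofReal (S.det.re ^ (n - k))
            ∂(hermMeasure k) = 0 := by
        rw [setLIntegral_congr_fun (g := fun _ => 0) (measurableSet_posDef k), lintegral_zero]
        intro S hS
        have hS' : S ∉ {S : Matrix (Fin k) (Fin k) ℂ | S.det = 0} := (PosDef.det_pos hS).ne'
        simp only [Set.indicator_of_notMem hS', zero_mul]
      rw [h0, mul_zero] at h
      filter_upwards [(lintegral_eq_zero_iff ((measurable_one.indicator hZ).comp hgram)).1 h] with Y hY h1
      simp [h1] at hY
    let Φ : Matrix (Fin k) (Fin k) ℂ → ENNReal := fun G =>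
      ENNReal.ofReal (π ^ d / Gamma d) * (ENNReal.ofReal (G.det.re)⁻¹ *
        ∫⁻ b : Fin k → ℂ, ∫⁻ t : ℝ, P.indicator f (borderedMatrix G b t) *
          ENNReal.ofReal (((borderedMatrix G b t).det.re / G.det.re) ^ (d - 1)))
    have hΦ : Measurable Φ := by
      refine (hdet.inv.ennreal_ofReal.mul ?_).const_mul _
      have hb : Measurable fun p : (Matrix (Fin k) (Fin k) ℂ × (Fin k → ℂ)) × ℝ =>
          borderedMatrix p.1.1 p.1.2 p.2 :=
        continuous_borderedMatrix.measurable.comp MeasurableEquiv.prodAssoc.measurable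
      have h1 : Measurable fun p : (Matrix (Fin k) (Fin k) ℂ × (Fin k → ℂ)) × ℝ =>
          P.indicator f (borderedMatrix p.1.1 p.1.2 p.2) * ENNReal.ofReal
            (((borderedMatrix p.1.1 p.1.2 p.2).det.re / p.1.1.det.re) ^ (d - 1)) :=
        ((hf.indicator hP).comp hb).mul (((hdet.comp hb).div
          (hdet.comp (measurable_fst.comp measurable_fst))).pow_const _).ennreal_ofReal
      exact (h1.lintegral_prod_right' (ν := volume)).lintegral_prod_right' (ν := volume)
    have hΦ_mul {G : Matrix (Fin k) (Fin k) ℂ} (hG : G.PosDef) :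
        Φ G * ENNReal.ofReal (G.det.re ^ d) = ENNReal.ofReal (π ^ d / Gamma d) *
          ∫⁻ b, ∫⁻ t, P.indicator (fun S => f S * ENNReal.ofReal (S.det.re ^ (d - 1)))
            (borderedMatrix G b t) := by
      have hpos : 0 < G.det.re := (Complex.lt_def.1 hG.det_pos).1
      simp only [Φ]
      rw [mul_assoc, mul_right_comm, ← ENNReal.ofReal_mul (by positivity),
        ← lintegral_const_mul' _ _ ENNReal.ofReal_ne_top]
      congr 1
      refine lintegral_congr fun b => ?_
      rw [← lintegral_const_mul' _ _ ENNReal.ofReal_ne_top]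
      refine lintegral_congr fun t => ?_
      by_cases hS : borderedMatrix G b t ∈ P
      · rw [Set.indicator_of_mem hS, Set.indicator_of_mem hS, mul_left_comm,
          ← ENNReal.ofReal_mul (by positivity)]
        congr 2
        obtain ⟨e, rfl⟩ : ∃ e, d = e + 1 := ⟨d - 1, by omega⟩
        rw [Nat.add_sub_cancel, div_pow, pow_succ]
        field_simp
      · rw [Set.indicator_of_notMem hS, Set.indicator_of_notMem hS, zero_mul, mul_zero]
    calc ∫⁻ X : Matrix (Fin n) (Fin (k + 1)) ℂ, f (Xᴴ * X)
        = ∫⁻ Y : Matrix (Fin n) (Fin k) ℂ, Φ (Yᴴ * Y) := by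
          rw [lintegral_conjTranspose_mul_self_succ hf]
          refine lintegral_congr_ae ?_
          filter_upwards [hae] with Y hY
          exact lintegral_borderedMatrix_gram hn Y hY hf
      _ = ENNReal.ofReal (π ^ ((k : ℝ) * n) / cmvGamma k n) *
          ∫⁻ G in {G : Matrix (Fin k) (Fin k) ℂ | G.PosDef},
            (ENNReal.ofReal (π ^ d / Gamma d) * ∫⁻ b, ∫⁻ t,
              P.indicator (fun S => f S * ENNReal.ofReal (S.det.re ^ (d - 1)))
                (borderedMatrix G b t)) ∂(hermMeasure k) := by
          rw [ih hkn hΦ, hnk]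
          congr 1
          exact setLIntegral_congr_fun (measurableSet_posDef k) fun G hG => hΦ_mul hG
      _ = _ := by
          have hmeas : Measurable
              (P.indicator fun S => f S * ENNReal.ofReal (S.det.re ^ (d - 1))) :=
            (hf.mul (hdet.pow_const _).ennreal_ofReal).indicator hP
          rw [lintegral_const_mul' _ _ ENNReal.ofReal_ne_top, ← mul_assoc,
            ← ENNReal.ofReal_mul, ← rpow_div_cmvGamma_succ hn hd, hnk',
            ← lintegral_indicator hP, lintegral_hermMeasure_succ hmeas,
            ← lintegral_indicator (measurableSet_posDef k)]
          · congr 1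
            refine lintegral_congr fun G => ?_
            refine Set.indicator_apply_eq_self.2 fun hG => ?_
            have h0 (b t) : borderedMatrix G b t ∉ P := fun h => hG (posDef_of_borderedMatrix h)
            simp [h0]
          · have : (k : ℝ) ≤ n := by exact_mod_cast hkn
            exact div_nonneg (rpow_nonneg pi_pos.le _) (cmvGamma_pos (by linarith)).le

/-- Complex (β = 2) combination of Proposition 2.3 with the Stiefel volume formula:
`∫_{ℂ^{n×m}} f(X*X) dX = (π^{mn}/Γ̃_m(n)) ∫_{S ≻ 0} f(S) (det S)^{n−m} dS`. -/
theorem integral_conjTranspose_mul_self_eq {n m : ℕ} (hm : 1 ≤ m) (hnm : m ≤ n)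
    (f : Matrix (Fin m) (Fin m) ℂ → ENNReal) (hf : Measurable f) :
    ∫⁻ X : Matrix (Fin n) (Fin m) ℂ, f (Xᴴ * X) =
      ENNReal.ofReal (π ^ ((m : ℝ) * n) / cmvGamma m (n : ℝ)) *
        ∫⁻ S in {S : Matrix (Fin m) (Fin m) ℂ | S.PosDef},
          f S * ENNReal.ofReal (S.det.re ^ (n - m)) ∂(hermMeasure m) :=
  lintegral_conjTranspose_mul_self hnm hf
end

section
/- Let n ≥ m ≥ 1 be integers and τ = (t_1,…,t_m) ∈ ℝ^m with t_1 ≥ … ≥ t_m and n/2 > (m−1)/2 − t_m. Let μ_0 ∈ ℝ^{n×m}, let Θ be an n×n positive definite real matrix, and let Σ = Tᵀ T be an m×m positive definite real matrix where T is upper triangular with positive diagonal entries. Then ∫_{ℝ^{n×m}} exp(−tr(Σ^{−1} (Y − μ_0)ᵀ Θ^{−1} (Y − μ_0))) q_τ(T^{−ᵀ} (Y − μ_0)ᵀ Θ^{−1} (Y − μ_0) T^{−1}) dY = π^{mn/2} Γ_m(n/2, τ) (det Σ)^{n/2} (det Θ)^{m/2} / Γ_m(n/2); that is, the Kotz-Riesz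 type I density integrates to one. -/
open MeasureTheory Matrix Real

theorem integral_exp_neg_sq_norm_mul_rpow {E : Type*} [NormedAddCommGroup E]
    [InnerProductSpace ℝ E] [FiniteDimensional ℝ E] [MeasurableSpace E] [BorelSpace E]
    (hE : 0 < Module.finrank ℝ E) (s : ℝ) (hs : 0 < (Module.finrank ℝ E : ℝ) / 2 + s) :
    ∫ x : E, rexp (-‖x‖ ^ 2) * (‖x‖ ^ 2) ^ s =
      π ^ ((Module.finrank ℝ E : ℝ) / 2) * Gamma ((Module.finrank ℝ E : ℝ) / 2 + s) /
        Gamma ((Module.finrank ℝ E : ℝ) / 2) := by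
  have : Nontrivial E := Module.nontrivial_of_finrank_pos hE
  set p := Module.finrank ℝ E with hp
  have hp' : (0 : ℝ) < p := by exact_mod_cast hE
  rw [integral_fun_norm_addHaar volume (fun y => rexp (-y ^ 2) * (y ^ 2) ^ s)]
  have h1 : ∫ y in Set.Ioi (0 : ℝ), y ^ (p - 1) • (rexp (-y ^ 2) * (y ^ 2) ^ s) =
      1 / 2 * Gamma ((p : ℝ) / 2 + s) := by
    have := integral_rpow_mul_exp_neg_rpow (p := 2) (q := p - 1 + 2 * s) two_pos (by linarith)
    rw [show ((p : ℝ) - 1 + 2 * s + 1) / 2 = p / 2 + s by ring] at this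
    rw [← this]
    refine setIntegral_congr_fun measurableSet_Ioi fun y hy => ?_
    have hy : 0 < y := hy
    simp only [smul_eq_mul]
    rw [rpow_add hy, rpow_mul hy.le, rpow_two, ← Nat.cast_pred hE, rpow_natCast]
    ring
  rw [← hp, h1]
  simp only [Measure.real, InnerProductSpace.volume_ball, nsmul_eq_mul, smul_eq_mul, ← hp]
  have hG : 0 < Gamma ((p : ℝ) / 2) := Gamma_pos_of_pos (by positivity)
  rw [ENNReal.toReal_mul, ENNReal.toReal_pow, ENNReal.toReal_ofReal zero_le_one,
    ENNReal.toReal_ofReal (div_nonneg (by positivity) (Gamma_pos_of_pos (by positivity)).le),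
    Gamma_add_one (by positivity), sqrt_eq_rpow, ← rpow_mul_natCast pi_pos.le,
    show 1 / 2 * (p : ℝ) = p / 2 by ring]
  field_simp
  simp

theorem integral_exp_neg_sq_norm_mul_orthogonal_rpow {E : Type*} [NormedAddCommGroup E]
    [InnerProductSpace ℝ E] [FiniteDimensional ℝ E] [MeasurableSpace E] [BorelSpace E]
    (V : Submodule ℝ E) (hV : 0 < Module.finrank ℝ Vᗮ) (s : ℝ)
    (hs : 0 < (Module.finrank ℝ Vᗮ : ℝ) / 2 + s) :
    ∫ x : E, rexp (-‖x‖ ^ 2) * (‖Vᗮ.orthogonalProjectionOnto x‖ ^ 2) ^ s =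
      π ^ ((Module.finrank ℝ E : ℝ) / 2) * Gamma ((Module.finrank ℝ Vᗮ : ℝ) / 2 + s) /
        Gamma ((Module.finrank ℝ Vᗮ : ℝ) / 2) := by
  have hmp := (WithLp.volume_preserving_symm_measurableEquiv_toLp_prod V Vᗮ).comp
    V.orthogonalDecomposition.measurePreserving
  have hemb : MeasurableEmbedding ((MeasurableEquiv.toLp 2 (V × Vᗮ)).symm ∘
      V.orthogonalDecomposition) := (MeasurableEquiv.measurableEmbedding _).comp
        V.orthogonalDecomposition.toHomeomorph.measurableEmbedding
  have h := hmp.integral_comp hemb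
    (fun z : V × Vᗮ => rexp (-‖z.1‖ ^ 2) * (rexp (-‖z.2‖ ^ 2) * (‖z.2‖ ^ 2) ^ s))
  have hprod := integral_prod_mul (μ := (volume : Measure V)) (ν := (volume : Measure Vᗮ))
    (fun x => rexp (-‖x‖ ^ 2)) (fun y => rexp (-‖y‖ ^ 2) * (‖y‖ ^ 2) ^ s)
  have hg := GaussianFourier.integral_rexp_neg_mul_sq_norm (V := V) (b := 1) one_pos
  simp only [neg_mul, one_mul, div_one] at hg
  rw [Measure.volume_eq_prod] at h
  rw [hprod, integral_exp_neg_sq_norm_mul_rpow hV s hs, hg] at h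
  rw [← V.finrank_add_finrank_orthogonal, Nat.cast_add, add_div, rpow_add pi_pos]
  refine Eq.trans (integral_congr_ae (.of_forall fun x => ?_)) (h.trans (by ring))
  simp [V.norm_sq_eq_add_norm_sq_projection x, exp_add, mul_assoc, add_comm]

/-- The matrix obtained from `A` by appending `z` as last column. -/
def snocCol {n k : ℕ} (A : Fin n → Fin k → ℝ) (z : Fin n → ℝ) : Matrix (Fin n) (Fin (k + 1)) ℝ :=
  fun i => Fin.snoc (α := fun _ => ℝ) (A i) (z i)

theorem det_gram_snocCol {n k : ℕ} (A : Matrix (Fin n) (Fin k) ℝ) (z : Fin n → ℝ) (c : Fin k → ℝ)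
    (hc : Aᵀ *ᵥ (z - A *ᵥ c) = 0) :
    ((snocCol A z)ᵀ * snocCol A z).det =
      (Aᵀ * A).det * ((z - A *ᵥ c) ⬝ᵥ (z - A *ᵥ c)) := by
  set w := z - A *ᵥ c with hw
  let N : Matrix (Fin n) (Fin k ⊕ Fin 1) ℝ := fromCols A (replicateCol (Fin 1) w)
  let U : Matrix (Fin k ⊕ Fin 1) (Fin k ⊕ Fin 1) ℝ := fromBlocks 1 (replicateCol (Fin 1) c) 0 1
  have hM : (snocCol A z).submatrix id finSumFinEquiv = N * U := by
    ext i j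
    rcases j with j | j
    · simp [N, U, snocCol, fromCols_mul_fromBlocks, Fin.snoc, Fin.castLT, Fin.castAdd]
    · obtain rfl : j = 0 := Subsingleton.elim _ _
      have : Fin.natAdd k (0 : Fin 1) = Fin.last k := by ext; simp
      simp [N, U, snocCol, this, w, mul_apply, mulVec, dotProduct]
  have hN : Nᵀ * N = fromBlocks (Aᵀ * A) 0 0 (of fun _ _ => w ⬝ᵥ w) := by
    have h1 : Aᵀ * replicateCol (Fin 1) w = 0 := by
      ext i j
      exact congrFun hc i
    have h2 : (replicateCol (Fin 1) w)ᵀ * A = 0 := by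
      rw [← transpose_inj, transpose_mul, transpose_transpose, h1, transpose_zero]
    rw [transpose_fromCols, fromRows_mul_fromCols, h1, h2]
    congr 1
  rw [← det_submatrix_equiv_self finSumFinEquiv,
    ← submatrix_mul_equiv _ _ _ (Equiv.refl (Fin n)), ← transpose_submatrix, Equiv.coe_refl, hM,
    transpose_mul, Matrix.mul_assoc, ← Matrix.mul_assoc Nᵀ, det_mul, det_mul, hN]
  simp [U, det_transpose]

theorem measurePreserving_snocCol (n k : ℕ) :
    MeasurePreserving (fun p : (Fin n → Fin k → ℝ) × (Fin n → ℝ) =>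
      (fun i => Fin.snoc (α := fun _ => ℝ) (p.1 i) (p.2 i) : Fin n → Fin (k + 1) → ℝ)) := by
  have h1 := (volume_measurePreserving_arrowProdEquivProdArrow ℝ (Fin k → ℝ) (Fin n)).symm
  have h2 := volume_preserving_pi (f := fun _ : Fin n => _) fun _ : Fin n =>
    (volume_preserving_piFinSuccAbove (fun _ : Fin (k + 1) => ℝ) (Fin.last k)).symm
  have h3 := h2.comp (h1.comp (Measure.measurePreserving_swap
    (μ := (volume : Measure (Fin n → Fin k → ℝ))) (ν := (volume : Measure (Fin n → ℝ)))))
  convert h3 using 1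
  swap
  · rfl
  ext p i j
  simp [MeasurableEquiv.piFinSuccAbove, MeasurableEquiv.arrowProdEquivProdArrow,
    Equiv.arrowProdEquivProdArrow]

theorem exists_submodule_det_gram_snocCol {n k : ℕ} (A : Matrix (Fin n) (Fin k) ℝ)
    (hA : (Aᵀ * A).det ≠ 0) :
    ∃ V : Submodule ℝ (EuclideanSpace ℝ (Fin n)), k + Module.finrank ℝ Vᗮ = n ∧
      ∀ z : Fin n → ℝ, ((snocCol A z)ᵀ * snocCol A z).det =
        (Aᵀ * A).det * ‖Vᗮ.orthogonalProjectionOnto (WithLp.toLp 2 z)‖ ^ 2 := by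
  let f := Matrix.toLpLin 2 2 A
  refine ⟨LinearMap.range f, ?_, fun z => ?_⟩
  · have h1 : Module.finrank ℝ (LinearMap.range f) = k := by
      have h2 : A.rank = k := by
        rw [← rank_transpose_mul_self,
          rank_of_isUnit _ ((isUnit_iff_isUnit_det _).2 (isUnit_iff_ne_zero.2 hA)), Fintype.card_fin]
      refine Eq.trans ?_ h2
      rw [rank_eq_finrank_range_toLin A (EuclideanSpace.basisFun (Fin n) ℝ).toBasis
        (EuclideanSpace.basisFun (Fin k) ℝ).toBasis]
      congr 2
    have h3 := (LinearMap.range f).finrank_add_finrank_orthogonal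
    rw [h1, finrank_euclideanSpace_fin] at h3
    exact h3
  · set V := LinearMap.range f
    obtain ⟨c, hc⟩ : ∃ c, f c = V.starProjection (WithLp.toLp 2 z) :=
      V.starProjection_apply_mem _
    have hw : WithLp.toLp 2 (z - A *ᵥ c.ofLp) =
        (Vᗮ.orthogonalProjectionOnto (WithLp.toLp 2 z) : EuclideanSpace ℝ (Fin n)) := by
      have := V.starProjection_add_starProjection_orthogonal (WithLp.toLp 2 z)
      rw [← Submodule.starProjection_apply, ← sub_eq_of_eq_add' this.symm, ← hc]
      rfl
    have hmem := (Vᗮ.orthogonalProjectionOnto (WithLp.toLp 2 z)).2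
    rw [← hw] at hmem
    have hn : ‖Vᗮ.orthogonalProjectionOnto (WithLp.toLp 2 z)‖ =
        ‖WithLp.toLp 2 (z - A *ᵥ c.ofLp)‖ := by rw [hw]; rfl
    rw [det_gram_snocCol A z c.ofLp, hn, EuclideanSpace.norm_sq_eq]
    · simp [dotProduct, sq]
    · ext i
      have := (Submodule.mem_orthogonal _ _).1 hmem (f (WithLp.toLp 2 (Pi.single i 1))) ⟨_, rfl⟩
      rw [EuclideanSpace.inner_eq_star_dotProduct] at this
      simpa [f, mulVec, dotProduct, mul_comm] using this

theorem leadMinor_self {m : ℕ} (A : Matrix (Fin m) (Fin m) ℝ) : leadMinor A m = A.det := by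
  simp [leadMinor]

theorem leadMinor_zero {m : ℕ} (A : Matrix (Fin m) (Fin m) ℝ) : leadMinor A 0 = 1 := by
  simp [leadMinor]

theorem leadMinor_submatrix_castSucc {k : ℕ} (A : Matrix (Fin (k + 1)) (Fin (k + 1)) ℝ) {i : ℕ}
    (hi : i ≤ k) : leadMinor (A.submatrix Fin.castSucc Fin.castSucc) i = leadMinor A i := by
  rw [leadMinor, leadMinor, dif_pos hi, dif_pos (hi.trans k.le_succ)]
  rfl

theorem hwVector_eq_mul_det_rpow {k : ℕ} (τ : Fin (k + 1) → ℝ)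
    (A : Matrix (Fin (k + 1)) (Fin (k + 1)) ℝ)
    (hA : 0 < (A.submatrix Fin.castSucc Fin.castSucc).det) :
    hwVector τ A =
      hwVector (fun i => τ i.castSucc) (A.submatrix Fin.castSucc Fin.castSucc) *
        (A.submatrix Fin.castSucc Fin.castSucc).det ^ (-τ (Fin.last k)) *
          A.det ^ τ (Fin.last k) := by
  rw [hwVector, Fin.prod_univ_castSucc]
  congr 1
  · rw [← leadMinor_self] at hA ⊢
    cases k with
    | zero => simp [hwVector, leadMinor_zero]
    | succ k =>
      rw [hwVector, Fin.prod_univ_castSucc, Fin.prod_univ_castSucc, mul_assoc]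
      congr 1
      · refine Finset.prod_congr rfl fun i _ => ?_
        have := i.2
        rw [leadMinor_submatrix_castSucc _ (by simp)]
        simp only [Fin.val_castSucc]
        rw [dif_pos (by omega), dif_pos (by omega)]
        rfl
      · simp only [Fin.val_castSucc, Fin.val_last]
        rw [← rpow_add hA, dif_pos (by omega), dif_neg (by omega),
          leadMinor_submatrix_castSucc _ le_rfl]
        congr 1
        rw [sub_zero, sub_eq_add_neg]
        rfl
  · simp [leadMinor_self]

/-- The unnormalized density of the standard Kotz-Riesz distribution of type I. -/
noncomputable def kotzRieszKernel {n m : ℕ} (τ : Fin m → ℝ) (Z : Matrix (Fin n) (Fin m) ℝ) : ℝ :=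
  rexp (-(Zᵀ * Z).trace) * hwVector τ (Zᵀ * Z)

theorem gram_submatrix_posSemidef {n m k : ℕ} (Z : Matrix (Fin n) (Fin m) ℝ)
    (e : Fin k → Fin m) : ((Zᵀ * Z).submatrix e e).PosSemidef := by
  have := (posSemidef_conjTranspose_mul_self Z).submatrix e
  rwa [conjTranspose_eq_transpose_of_trivial] at this

theorem det_gram_nonneg {n m : ℕ} (Z : Matrix (Fin n) (Fin m) ℝ) : 0 ≤ (Zᵀ * Z).det := by
  simpa using (gram_submatrix_posSemidef Z id).det_nonneg

theorem kotzRieszKernel_nonneg {n m : ℕ} (τ : Fin m → ℝ) (Z : Matrix (Fin n) (Fin m) ℝ) :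
    0 ≤ kotzRieszKernel τ Z := by
  refine mul_nonneg (exp_pos _).le (Finset.prod_nonneg fun i _ => rpow_nonneg ?_ _)
  rw [leadMinor]
  split_ifs
  · exact (gram_submatrix_posSemidef Z _).det_nonneg
  · exact le_rfl

theorem measurable_kotzRieszKernel {n m : ℕ} (τ : Fin m → ℝ) :
    Measurable fun Z : Fin n → Fin m → ℝ => kotzRieszKernel τ (Matrix.of Z) := by
  have hgram : Continuous fun Z : Fin n → Fin m → ℝ =>
      (Matrix.of Z)ᵀ * Matrix.of Z := by
    have : Continuous fun Z : Fin n → Fin m → ℝ => Matrix.of Z := continuous_id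
    exact this.matrix_transpose.matrix_mul this
  refine Measurable.mul (hgram.matrix_trace.neg.rexp.measurable)
    (Finset.measurable_prod _ fun i _ => Measurable.pow_const (Continuous.measurable ?_) _)
  have hi : (i : ℕ) + 1 ≤ m := i.2
  simp only [leadMinor, dif_pos hi]
  exact (hgram.matrix_submatrix _ _).matrix_det

theorem measurable_det_gram (n m : ℕ) :
    Measurable fun Z : Fin n → Fin m → ℝ => ((Matrix.of Z)ᵀ * Matrix.of Z).det := by
  have : Continuous fun Z : Fin n → Fin m → ℝ => Matrix.of Z := continuous_id
  exact (this.matrix_transpose.matrix_mul this).matrix_det.measurable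

theorem gram_snocCol_submatrix {n k : ℕ} (A : Matrix (Fin n) (Fin k) ℝ) (z : Fin n → ℝ) :
    ((snocCol A z)ᵀ * snocCol A z).submatrix Fin.castSucc Fin.castSucc = Aᵀ * A := by
  ext i j
  simp [mul_apply, snocCol]

theorem trace_gram_snocCol {n k : ℕ} (A : Matrix (Fin n) (Fin k) ℝ) (z : Fin n → ℝ) :
    ((snocCol A z)ᵀ * snocCol A z).trace = (Aᵀ * A).trace + ‖WithLp.toLp 2 z‖ ^ 2 := by
  rw [EuclideanSpace.norm_sq_eq]
  simp [trace, Fin.sum_univ_castSucc, mul_apply, snocCol, sq]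

theorem kotzRieszKernel_snocCol {n k : ℕ} (τ : Fin (k + 1) → ℝ) (A : Matrix (Fin n) (Fin k) ℝ)
    (hA : 0 < (Aᵀ * A).det) (z : Fin n → ℝ) {r : ℝ} (hr : 0 ≤ r)
    (hz : ((snocCol A z)ᵀ * snocCol A z).det = (Aᵀ * A).det * r) :
    kotzRieszKernel τ (snocCol A z) = kotzRieszKernel (fun i => τ i.castSucc) A *
      (rexp (-‖WithLp.toLp 2 z‖ ^ 2) * r ^ τ (Fin.last k)) := by
  have h := gram_snocCol_submatrix A z
  rw [kotzRieszKernel, kotzRieszKernel, hwVector_eq_mul_det_rpow _ _ (h ▸ hA), h, hz,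
    trace_gram_snocCol, neg_add, exp_add, mul_rpow hA.le hr, rpow_neg hA.le]
  have := (rpow_pos_of_pos hA (τ (Fin.last k))).ne'
  field_simp

theorem ae_det_gram_pos {n m : ℕ} (hmn : m ≤ n) :
    ∀ᵐ Z : Fin n → Fin m → ℝ, 0 < ((Matrix.of Z)ᵀ * Matrix.of Z).det := by
  induction m with
  | zero => simp
  | succ k ih =>
    have hset := measurableSet_lt (measurable_const (a := (0 : ℝ)))
      (measurable_det_gram n (k + 1))
    rw [← (measurePreserving_snocCol n k).map_eq,
      ae_map_iff (measurePreserving_snocCol n k).measurable.aemeasurable hset]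
    refine (Measure.ae_prod_iff_ae_ae ((measurePreserving_snocCol n k).measurable hset)).2 ?_
    filter_upwards [ih (by omega)] with A hA
    obtain ⟨V, hV, hdet⟩ := exists_submodule_det_gram_snocCol (Matrix.of A) hA.ne'
    have hVtop : V ≠ ⊤ := by
      rintro rfl
      rw [Submodule.top_orthogonal_eq_bot, finrank_bot] at hV
      omega
    have hnull : ∀ᵐ z : EuclideanSpace ℝ (Fin n), z ∉ V :=
      measure_eq_zero_iff_ae_notMem.1 (Measure.addHaar_submodule volume V hVtop)
    filter_upwards [(PiLp.volume_preserving_toLp (Fin n)).quasiMeasurePreserving.ae hnull] with z hz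
    refine lt_of_lt_of_eq ?_ (hdet z).symm
    refine mul_pos hA (pow_pos (norm_pos_iff.2 fun h0 => hz ?_) 2)
    rw [Submodule.orthogonalProjectionOnto_eq_zero_iff, Submodule.orthogonal_orthogonal] at h0
    exact h0

theorem lintegral_kotzRieszKernel {n m : ℕ} (hmn : m ≤ n) (τ : Fin m → ℝ)
    (hτ : ∀ i, 0 < ((n : ℝ) - i) / 2 + τ i) :
    ∫⁻ Z : Fin n → Fin m → ℝ, ENNReal.ofReal (kotzRieszKernel τ (Matrix.of Z)) =
      ENNReal.ofReal (∏ i : Fin m, π ^ ((n : ℝ) / 2) * Gamma (((n : ℝ) - i) / 2 + τ i) /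
        Gamma (((n : ℝ) - i) / 2)) := by
  induction m with
  | zero => simp [lintegral_unique, kotzRieszKernel, hwVector, volume_pi, Measure.pi_univ]
  | succ k ih =>
    set c : ℝ := π ^ ((n : ℝ) / 2) * Gamma (((n : ℝ) - k) / 2 + τ (Fin.last k)) /
      Gamma (((n : ℝ) - k) / 2) with hc
    have hkn : (0 : ℝ) < ((n : ℝ) - k) / 2 := by
      have : (k : ℝ) < n := by exact_mod_cast hmn
      linarith
    have hτk := hτ (Fin.last k)
    rw [Fin.val_last] at hτk
    have hcpos : 0 < c := div_pos (mul_pos (by positivity) (Gamma_pos_of_pos hτk))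
      (Gamma_pos_of_pos hkn)
    have hmeas : Measurable fun Z : Fin n → Fin (k + 1) → ℝ =>
      ENNReal.ofReal (kotzRieszKernel τ (Matrix.of Z)) := (measurable_kotzRieszKernel τ).ennreal_ofReal
    refine ((measurePreserving_snocCol n k).lintegral_comp hmeas).symm.trans ((lintegral_prod _
      (hmeas.comp (measurePreserving_snocCol n k).measurable).aemeasurable).trans ?_)
    rw [Fin.prod_univ_castSucc]
    simp only [Fin.val_last, Fin.val_castSucc, ← hc]
    rw [ENNReal.ofReal_mul' hcpos.le, ← ih (by omega) (fun i => τ i.castSucc) (fun i => hτ i.castSucc),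
      ← lintegral_mul_const _ (measurable_kotzRieszKernel _).ennreal_ofReal]
    refine lintegral_congr_ae ?_
    filter_upwards [ae_det_gram_pos (n := n) (m := k) (by omega)] with A hA
    obtain ⟨V, hV, hdet⟩ := exists_submodule_det_gram_snocCol (Matrix.of A) hA.ne'
    have hVn : (Module.finrank ℝ Vᗮ : ℝ) = n - k := by
      rw [eq_sub_iff_add_eq']
      exact_mod_cast hV
    have hint := integral_exp_neg_sq_norm_mul_orthogonal_rpow V (by omega) (τ (Fin.last k))
      (by rwa [hVn])
    rw [hVn, finrank_euclideanSpace_fin, ← hc] at hint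
    rw [← hint, ofReal_integral_eq_lintegral_ofReal
      (not_imp_comm.1 integral_undef (hint ▸ hcpos.ne'))
      (.of_forall fun x => by positivity),
      ← (PiLp.volume_preserving_toLp (Fin n)).lintegral_comp_emb
        (MeasurableEquiv.toLp 2 (Fin n → ℝ)).measurableEmbedding,
      ← lintegral_const_mul' _ _ ENNReal.ofReal_ne_top]
    refine lintegral_congr fun z => ?_
    rw [← ENNReal.ofReal_mul (kotzRieszKernel_nonneg _ _)]
    exact congrArg ENNReal.ofReal
      (kotzRieszKernel_snocCol τ (Matrix.of A) hA z (by positivity) (hdet z))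

theorem integral_kotzRieszKernel {n m : ℕ} (hmn : m ≤ n) (τ : Fin m → ℝ)
    (hτ : ∀ i, 0 < ((n : ℝ) - i) / 2 + τ i) :
    ∫ Z : Fin n → Fin m → ℝ, kotzRieszKernel τ (Matrix.of Z) =
      ∏ i : Fin m, π ^ ((n : ℝ) / 2) * Gamma (((n : ℝ) - i) / 2 + τ i) /
        Gamma (((n : ℝ) - i) / 2) := by
  rw [integral_eq_lintegral_of_nonneg_ae (.of_forall fun Z => kotzRieszKernel_nonneg τ (Matrix.of Z))
    (measurable_kotzRieszKernel τ).aestronglyMeasurable, lintegral_kotzRieszKernel hmn τ hτ,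
    ENNReal.toReal_ofReal]
  refine Finset.prod_nonneg fun i _ => div_nonneg
    (mul_nonneg (by positivity) (Gamma_pos_of_pos (hτ i)).le) (Gamma_pos_of_pos ?_).le
  have : ((i : ℕ) : ℝ) < n := by exact_mod_cast i.2.trans_le hmn
  linarith

/-- The linear map `Y ↦ B * Y * S` on rectangular matrices. -/
def mulLeftRight {n m : ℕ} (B : Matrix (Fin n) (Fin n) ℝ) (S : Matrix (Fin m) (Fin m) ℝ) :
    (Fin n → Fin m → ℝ) →ₗ[ℝ] (Fin n → Fin m → ℝ) where
  toFun Y := B * Matrix.of Y * S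
  map_add' X Y := by
    rw [← Matrix.of_add_of, Matrix.mul_add, Matrix.add_mul]
    rfl
  map_smul' c Y := by
    rw [← Matrix.smul_of, Matrix.mul_smul, Matrix.smul_mul]
    rfl

/-- Vectorization by columns as a linear equivalence. -/
def vecLinearEquiv (n m : ℕ) : (Fin n → Fin m → ℝ) ≃ₗ[ℝ] (Fin m × Fin n → ℝ) where
  toFun Y := vec (Matrix.of Y)
  invFun v i j := v (j, i)
  map_add' _ _ := rfl
  map_smul' _ _ := rfl
  left_inv _ := rfl
  right_inv _ := rfl

theorem det_mulLeftRight {n m : ℕ} (B : Matrix (Fin n) (Fin n) ℝ) (S : Matrix (Fin m) (Fin m) ℝ) :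
    LinearMap.det (mulLeftRight B S) = B.det ^ m * S.det ^ n := by
  have h : (vecLinearEquiv n m : _ →ₗ[ℝ] _) ∘ₗ mulLeftRight B S ∘ₗ
      ((vecLinearEquiv n m).symm : _ →ₗ[ℝ] _) = toLin' (kroneckerMap (· * ·) Sᵀ B) := by
    refine LinearMap.ext fun v => ?_
    obtain ⟨Y, rfl⟩ := (vecLinearEquiv n m).surjective v
    have := kronecker_mulVec_vec B (Matrix.of Y) Sᵀ
    rw [transpose_transpose] at this
    simp only [LinearMap.comp_apply, LinearEquiv.coe_coe, LinearEquiv.symm_apply_apply,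
      toLin'_apply]
    exact this.symm
  rw [← LinearMap.det_conj _ (vecLinearEquiv n m), h, LinearMap.det_toLin', det_kronecker,
    det_transpose]
  simp [mul_comm]

theorem integral_comp_mulLeftRight_sub {n m : ℕ} (B : Matrix (Fin n) (Fin n) ℝ)
    (S : Matrix (Fin m) (Fin m) ℝ) (hB : B.det ≠ 0) (hS : S.det ≠ 0)
    (f : (Fin n → Fin m → ℝ) → ℝ) (hf : Measurable f) (c : Fin n → Fin m → ℝ) :
    ∫ Y, f (mulLeftRight B S (Y - c)) = |B.det ^ m * S.det ^ n|⁻¹ * ∫ Z, f Z := by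
  have hdet : LinearMap.det (mulLeftRight B S) ≠ 0 := by
    rw [det_mulLeftRight]
    positivity
  have hL : Measurable (mulLeftRight B S) :=
    (LinearMap.continuous_of_finiteDimensional _).measurable
  rw [integral_sub_right_eq_self (fun Y => f (mulLeftRight B S Y)) c,
    ← integral_map hL.aemeasurable hf.aestronglyMeasurable,
    Measure.map_linearMap_addHaar_eq_smul_addHaar volume hdet, integral_smul_measure,
    ENNReal.toReal_ofReal (abs_nonneg _), det_mulLeftRight, abs_inv, smul_eq_mul]

theorem abs_pow_eq_sq_rpow (x : ℝ) (k : ℕ) : |x| ^ k = (x ^ 2) ^ ((k : ℝ) / 2) := by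
  rw [← sq_abs, ← rpow_two, ← rpow_mul (abs_nonneg x), mul_div_cancel₀ _ two_ne_zero, rpow_natCast]

theorem prod_gamma_ratio (n : ℕ) {m : ℕ} (τ : Fin m → ℝ) :
    (∏ i : Fin m, π ^ ((n : ℝ) / 2) * Gamma (((n : ℝ) - i) / 2 + τ i) /
        Gamma (((n : ℝ) - i) / 2)) =
      π ^ ((m : ℝ) * n / 2) * mvGammaW ((n : ℝ) / 2) τ / mvGamma m ((n : ℝ) / 2) := by
  have hpi : (π ^ ((n : ℝ) / 2)) ^ m = π ^ ((m : ℝ) * n / 2) := by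
    rw [← rpow_mul_natCast pi_pos.le]
    ring_nf
  have h0 : π ^ ((m : ℝ) * ((m : ℝ) - 1) / 4) ≠ 0 := (rpow_pos_of_pos pi_pos _).ne'
  rw [Finset.prod_div_distrib, Finset.prod_mul_distrib, Finset.prod_const, Finset.card_univ,
    Fintype.card_fin, hpi, mvGammaW, mvGamma, mul_left_comm, mul_div_mul_left _ _ h0]
  simp only [sub_div, sub_add_eq_add_sub]

open scoped MatrixOrder Matrix.Norms.L2Operator in
theorem exists_eq_transpose_mul_self {n : ℕ} {A : Matrix (Fin n) (Fin n) ℝ} (hA : A.PosSemidef) :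
    ∃ B : Matrix (Fin n) (Fin n) ℝ, A = Bᵀ * B := by
  obtain ⟨B, hB⟩ := CStarAlgebra.nonneg_iff_eq_star_mul_self.mp hA.nonneg
  exact ⟨B, hB⟩

/-- Normalization of the real (β = 1) Kotz-Riesz type I density (Definition 2.1): for
`t_1 ≥ … ≥ t_m`, `n/2 > (m−1)/2 − t_m`, `Θ ≻ 0` (`n × n`), `Σ = TᵀT ≻ 0` (`m × m`) with `T`
upper triangular with positive diagonal, and `μ₀ ∈ ℝ^{n×m}`,
`∫ exp(−tr(Σ⁻¹(Y−μ₀)ᵀΘ⁻¹(Y−μ₀))) q_τ(T^{−ᵀ}(Y−μ₀)ᵀΘ⁻¹(Y−μ₀)T⁻¹) dY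
  = π^{mn/2} Γ_m(n/2, τ) (det Σ)^{n/2} (det Θ)^{m/2} / Γ_m(n/2)`. -/
theorem kotz_riesz_density_normalization {n m : ℕ} (hm : 1 ≤ m) (hnm : m ≤ n)
    (τ : Fin m → ℝ) (hτ : Antitone τ)
    (hn : ((m : ℝ) - 1) / 2 - τ ⟨m - 1, by omega⟩ < (n : ℝ) / 2)
    (μ₀ : Matrix (Fin n) (Fin m) ℝ)
    (Θ : Matrix (Fin n) (Fin n) ℝ) (hΘ : Θ.PosDef)
    (T : Matrix (Fin m) (Fin m) ℝ) (hT : T.BlockTriangular id) (hTd : ∀ i, 0 < T i i)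
    (Sig : Matrix (Fin m) (Fin m) ℝ) (hSig : Sig = Tᵀ * T) (hSigPD : Sig.PosDef) :
    ∫ Y : Matrix (Fin n) (Fin m) ℝ,
        Real.exp (-(Sig⁻¹ * (Y - μ₀)ᵀ * Θ⁻¹ * (Y - μ₀)).trace) *
          hwVector τ ((T⁻¹)ᵀ * (Y - μ₀)ᵀ * Θ⁻¹ * (Y - μ₀) * T⁻¹) =
      π ^ ((m : ℝ) * n / 2) * mvGammaW ((n : ℝ) / 2) τ *
          Sig.det ^ ((n : ℝ) / 2) * Θ.det ^ ((m : ℝ) / 2) / mvGamma m ((n : ℝ) / 2) := by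
  obtain ⟨B, hB⟩ := exists_eq_transpose_mul_self hΘ.inv.posSemidef
  have hΘdet : Θ.det = (B.det ^ 2)⁻¹ := by
    have := congrArg det hB
    rw [det_nonsing_inv, Ring.inverse_eq_inv', det_mul, det_transpose] at this
    rw [← inv_inv Θ.det, this, sq]
  have hSdet : Sig.det = T.det ^ 2 := by rw [hSig, det_mul, det_transpose, sq]
  have hB0 : B.det ≠ 0 := fun h => hΘ.det_pos.ne' (by simp [hΘdet, h])
  have hT0 : T.det ≠ 0 := fun h => hSigPD.det_pos.ne' (by simp [hSdet, h])
  have hTi0 : T⁻¹.det ≠ 0 := by simpa [det_nonsing_inv] using hT0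
  have hτ' : ∀ i : Fin m, 0 < ((n : ℝ) - i) / 2 + τ i := fun i => by
    have hi : i ≤ ⟨m - 1, by omega⟩ := Fin.le_def.2 (by have := i.2; simp; omega)
    have h1 := hτ hi
    have h2 : ((i : ℕ) : ℝ) ≤ m - 1 := by
      rw [le_sub_iff_add_le]
      exact_mod_cast i.2
    linarith
  have hintegrand : ∀ Y : Matrix (Fin n) (Fin m) ℝ,
      rexp (-(Sig⁻¹ * (Y - μ₀)ᵀ * Θ⁻¹ * (Y - μ₀)).trace) *
          hwVector τ ((T⁻¹)ᵀ * (Y - μ₀)ᵀ * Θ⁻¹ * (Y - μ₀) * T⁻¹) =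
        kotzRieszKernel τ (B * (Y - μ₀) * T⁻¹) := fun Y => by
    have h1 : (T⁻¹)ᵀ * (Y - μ₀)ᵀ * Θ⁻¹ * (Y - μ₀) * T⁻¹ =
        (B * (Y - μ₀) * T⁻¹)ᵀ * (B * (Y - μ₀) * T⁻¹) := by
      simp only [hB, transpose_mul, Matrix.mul_assoc]
    have h2 : (Sig⁻¹ * (Y - μ₀)ᵀ * Θ⁻¹ * (Y - μ₀)).trace =
        ((T⁻¹)ᵀ * (Y - μ₀)ᵀ * Θ⁻¹ * (Y - μ₀) * T⁻¹).trace := by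
      rw [trace_mul_comm _ T⁻¹, hSig, Matrix.mul_inv_rev, transpose_nonsing_inv]
      simp only [Matrix.mul_assoc]
    rw [h2, h1, kotzRieszKernel]
  simp only [hintegrand]
  refine (integral_comp_mulLeftRight_sub B T⁻¹ hB0 hTi0 _
    (measurable_kotzRieszKernel τ) μ₀).trans ?_
  rw [integral_kotzRieszKernel hnm τ hτ', prod_gamma_ratio, hSdet, hΘdet,
    inv_rpow (sq_nonneg _), ← abs_pow_eq_sq_rpow, ← abs_pow_eq_sq_rpow, det_nonsing_inv,
    Ring.inverse_eq_inv', abs_mul, abs_pow, abs_pow, abs_inv, inv_pow, mul_inv, inv_inv]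
  ring
end
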